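/- Let P_Z be a probability distribution on ℝ defining a BMS channel in multiplicative-noise form with capacity C ∈ (0,1). Let (r_n, m_n) be a sequence of integer pairs with 0 ≤ r_n ≤ m_n, m_n strictly increasing, and R(r_n, m_n) → R for some R ∈ [0, C). For each n, let X^{(n)} be uniform on the BPSK image of RM(r_n, m_n), let Z^{(n)} ∈ ℝ^{2^{m_n}} have i.i.d. components with law P_Z independent of X^{(n)}, and let Y^{(n)} = X^{(n)} ⊙ Z^{(n)}. Then max_{i} BER(X_i^{(n)} | Y^{(n)}) → 0 as n → ∞. -/

import Mathlib

open MeasureTheory ProbabilityTheory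

noncomputable section

/-- The binary entropy function (base 2). -/
def hb (p : ℝ) : ℝ := -(p * Real.logb 2 p) - (1 - p) * Real.logb 2 (1 - p)

/-- Conditional expectation `E[X | W]` of `X` given the σ-algebra generated by `W`. -/
def condMean {Ω β E : Type*} [MeasurableSpace Ω] [MeasurableSpace β]
    [NormedAddCommGroup E] [NormedSpace ℝ E] [CompleteSpace E]
    (μ : Measure Ω) (X : Ω → E) (W : Ω → β) : Ω → E :=
  μ[X | MeasurableSpace.comap W inferInstance]

/-- Bit-error probability of the MAP decision rule for `X ∈ {±1}` given `W`. -/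
def BER {Ω β : Type*} [MeasurableSpace Ω] [MeasurableSpace β]
    (μ : Measure Ω) (X : Ω → ℝ) (W : Ω → β) : ℝ :=
  (1 - ∫ ω, |condMean μ X W ω| ∂μ) / 2

/-- Minimum mean squared error of estimating `X` from `W`. -/
def mmse {Ω β : Type*} [MeasurableSpace Ω] [MeasurableSpace β]
    (μ : Measure Ω) (X : Ω → ℝ) (W : Ω → β) : ℝ :=
  ∫ ω, (X ω - condMean μ X W ω) ^ 2 ∂μ

/-- Uniform distribution on `{-1, 1} ⊆ ℝ`. -/
def signMeasure : Measure ℝ := (2 : ENNReal)⁻¹ • (Measure.dirac (-1) + Measure.dirac 1)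

/-- Capacity of the BMS channel (in multiplicative-noise form) with noise law `PZ`:
`C = 1 - E[h_b((1 + E[X_u | Y_u])/2)]` where `X_u` is uniform on `{±1}`, independent of
`Z₀ ~ PZ`, and `Y_u = X_u · Z₀`. -/
def capacity (PZ : Measure ℝ) : ℝ :=
  1 - ∫ p, hb ((1 + condMean (signMeasure.prod PZ)
        (fun q : ℝ × ℝ => q.1) (fun q : ℝ × ℝ => q.1 * q.2) p) / 2) ∂(signMeasure.prod PZ)

/-- Evaluation vector of the multilinear polynomial whose coefficients on monomials
of degree at most `r` are given by `α` (higher-degree coefficients being ignored),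
evaluated at the point `v ∈ 𝔽₂^m` with index `i = Σ_j v_j 2^j`. -/
def RMword (r m : ℕ) (α : Finset (Fin m) → ZMod 2) : Fin (2 ^ m) → ZMod 2 :=
  fun i => ∑ S ∈ Finset.univ.filter (fun S : Finset (Fin m) => S.card ≤ r),
    α S * ∏ j ∈ S, ((((i : ℕ) / 2 ^ (j : ℕ)) % 2 : ℕ) : ZMod 2)

/-- The Reed–Muller code RM(r, m) ⊆ 𝔽₂^{2^m}. -/
def RMcode (r m : ℕ) : Finset (Fin (2 ^ m) → ZMod 2) :=
  Finset.image (RMword r m) Finset.univ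

/-- The rate `R(r,m)` of RM(r,m). -/
def RMrate (r m : ℕ) : ℝ := (2 ^ m : ℝ)⁻¹ * ∑ i ∈ Finset.range (r + 1), (m.choose i : ℝ)

/-- BPSK modulation map `c ↦ ((-1)^{c_0}, …, (-1)^{c_{N-1}})`. -/
def bpsk {N : ℕ} (c : Fin N → ZMod 2) : Fin N → ℝ := fun i => (-1 : ℝ) ^ ((c i).val)

/-- BPSK image of a binary code. -/
def bpskImage {N : ℕ} (C : Finset (Fin N → ZMod 2)) : Finset (Fin N → ℝ) :=
  letI := Classical.decEq (Fin N → ℝ)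
  C.image bpsk

/-- BPSK image of RM(r,m). -/
def bpskRM (r m : ℕ) : Finset (Fin (2 ^ m) → ℝ) := bpskImage (RMcode r m)

/-- Uniform probability measure on a finite set. -/
def uniformOnFinset {α : Type*} [MeasurableSpace α] (s : Finset α) : Measure α :=
  (s.card : ENNReal)⁻¹ • ∑ x ∈ s, Measure.dirac x

/-- `ρ(m) = (6 ln m + 34)/(5 √m)`. -/
def rho (m : ℕ) : ℝ := (6 * Real.log m + 34) / (5 * Real.sqrt m)

/-- Inverse of the binary entropy function restricted to `[0, 1/2]`. -/
def hbInv (u : ℝ) : ℝ := sSup {p : ℝ | p ∈ Set.Icc (0 : ℝ) (1 / 2) ∧ hb p ≤ u}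

/-- `ψ(u) = 1 - (1 - 2 h_b^{-1}(u))²`. -/
def psi (u : ℝ) : ℝ := 1 - (1 - 2 * hbInv u) ^ 2

/-- `Ψ(u) = ∫₀^u ψ(v) dv`. -/
def PsiInt (u : ℝ) : ℝ := ∫ v in (0 : ℝ)..u, psi v

/-- The coefficients `c_k = 1/(ln 2 · 2k (2k-1))`. -/
def ck (k : ℕ) : ℝ := 1 / (Real.log 2 * (2 * k) * (2 * k - 1))

/-- The channel moments `q_k = E[(E[X_u | Y_u])^{2k}]` for uniform input. -/
def qmom (PZ : Measure ℝ) (k : ℕ) : ℝ :=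
  ∫ p, (condMean (signMeasure.prod PZ)
      (fun q : ℝ × ℝ => q.1) (fun q : ℝ × ℝ => q.1 * q.2) p) ^ (2 * k) ∂(signMeasure.prod PZ)

end



/-! ### Bounded measurable functions -/

/-- Bounded measurable real functions. -/
def BM {α : Type*} [MeasurableSpace α] (f : α → ℝ) : Prop := Measurable f ∧ ∃ K, ∀ x, |f x| ≤ K

namespace BM
variable {α β : Type*} [MeasurableSpace α] [MeasurableSpace β]

lemma const (c : ℝ) : BM (fun _ : α => c) := ⟨measurable_const, |c|, fun _ => le_rfl⟩

lemma add {f g : α → ℝ} (hf : BM f) (hg : BM g) : BM (fun x => f x + g x) := by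
  obtain ⟨hf, K, hK⟩ := hf
  obtain ⟨hg, K', hK'⟩ := hg
  exact ⟨hf.add hg, K + K', fun x => (abs_add_le _ _).trans (add_le_add (hK x) (hK' x))⟩

lemma mul {f g : α → ℝ} (hf : BM f) (hg : BM g) : BM (fun x => f x * g x) := by
  obtain ⟨hf, K, hK⟩ := hf
  obtain ⟨hg, K', hK'⟩ := hg
  refine ⟨hf.mul hg, K * K', fun x => ?_⟩
  rw [abs_mul]
  exact mul_le_mul (hK x) (hK' x) (abs_nonneg _) ((abs_nonneg _).trans (hK x))

lemma neg {f : α → ℝ} (hf : BM f) : BM (fun x => - f x) := by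
  obtain ⟨hf, K, hK⟩ := hf
  exact ⟨hf.neg, K, fun x => by rw [abs_neg]; exact hK x⟩

lemma sub {f g : α → ℝ} (hf : BM f) (hg : BM g) : BM (fun x => f x - g x) := by
  simpa only [sub_eq_add_neg] using hf.add hg.neg

lemma abs {f : α → ℝ} (hf : BM f) : BM (fun x => |f x|) := by
  obtain ⟨hf, K, hK⟩ := hf
  exact ⟨measurable_abs.comp hf, K, fun x => by rw [abs_abs]; exact hK x⟩

lemma pow {f : α → ℝ} (hf : BM f) (n : ℕ) : BM (fun x => f x ^ n) := by
  induction n with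
  | zero => simpa using const (α := α) 1
  | succ n ih => simpa only [pow_succ] using ih.mul hf

lemma comp {f : β → ℝ} (hf : BM f) {e : α → β} (he : Measurable e) : BM (fun x => f (e x)) :=
  ⟨hf.1.comp he, hf.2.imp fun _ h _ => h _⟩

lemma sum {ι : Type*} (s : Finset ι) {f : ι → α → ℝ} (hf : ∀ i, BM (f i)) :
    BM (fun x => ∑ i ∈ s, f i x) := by
  classical
  induction s using Finset.induction_on with
  | empty => simpa using const (α := α) 0
  | insert a s ha ih => simpa only [Finset.sum_insert ha] using (hf a).add ih

lemma prod {ι : Type*} (s : Finset ι) {f : ι → α → ℝ} (hf : ∀ i, BM (f i)) :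
    BM (fun x => ∏ i ∈ s, f i x) := by
  classical
  induction s using Finset.induction_on with
  | empty => simpa using const (α := α) 1
  | insert a s ha ih => simpa only [Finset.prod_insert ha] using (hf a).mul ih

lemma integrable {f : α → ℝ} (hf : BM f) (μ : Measure α) [IsFiniteMeasure μ] : Integrable f μ := by
  obtain ⟨hf, K, hK⟩ := hf
  exact Integrable.of_bound hf.aestronglyMeasurable K (Filter.Eventually.of_forall hK)

end BM

/-! ### Integrating out one coordinate of a product measure -/

section Marginal

variable {ι : Type*} [Fintype ι] [DecidableEq ι] (μ : Measure ℝ) [IsProbabilityMeasure μ]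

lemma measurable_update_pair (i : ι) :
    Measurable (fun p : (ι → ℝ) × ℝ => Function.update p.1 i p.2) := by
  rw [measurable_pi_iff]
  intro j
  by_cases h : j = i
  · subst h; simpa using measurable_snd
  · simp only [Function.update_of_ne h]
    exact (measurable_pi_apply j).comp measurable_fst

lemma mp_update (i : ι) :
    MeasurePreserving (fun p : (ι → ℝ) × ℝ => Function.update p.1 i p.2)
      ((Measure.pi fun _ => μ).prod μ) (Measure.pi fun _ => μ) := by
  refine ⟨measurable_update_pair i, ?_⟩
  symm
  apply Measure.pi_eq
  intro s hs
  rw [Measure.map_apply (measurable_update_pair i) (MeasurableSet.univ_pi hs)]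
  have : (fun p : (ι → ℝ) × ℝ => Function.update p.1 i p.2) ⁻¹' (Set.univ.pi s)
      = (Set.univ.pi (Function.update s i Set.univ)) ×ˢ (s i) := by
    ext ⟨z, t⟩
    simp only [Set.mem_preimage, Set.mem_pi, Set.mem_univ, true_implies, Set.mem_prod]
    constructor
    · intro h
      refine ⟨fun j => ?_, by simpa using h i⟩
      by_cases hj : j = i
      · subst hj; simp
      · simpa [hj] using h j
    · rintro ⟨h, h'⟩ j
      by_cases hj : j = i
      · subst hj; simpa using h'
      · simpa [hj] using h j
  rw [this, Measure.prod_prod, Measure.pi_pi, ← Finset.mul_prod_erase _ _ (Finset.mem_univ i),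
    ← Finset.mul_prod_erase Finset.univ (fun j => μ (s j)) (Finset.mem_univ i)]
  simp only [Function.update_self, measure_univ, one_mul]
  rw [mul_comm]
  congr 1
  apply Finset.prod_congr rfl
  intro j hj
  rw [Function.update_of_ne (Finset.ne_of_mem_erase hj)]

/-- Integrate out coordinate `i`. -/
noncomputable def Ei (i : ι) (F : (ι → ℝ) → ℝ) : (ι → ℝ) → ℝ :=
  fun z => ∫ t, F (Function.update z i t) ∂μ

lemma BM.update {F : (ι → ℝ) → ℝ} (hF : BM F) (i : ι) (z : ι → ℝ) :
    BM (fun t : ℝ => F (Function.update z i t)) :=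
  hF.comp (measurable_update z)

lemma BM.Ei {F : (ι → ℝ) → ℝ} (hF : BM F) (i : ι) : BM (Ei μ i F) := by
  refine ⟨?_, ?_⟩
  · have : StronglyMeasurable (fun p : (ι → ℝ) × ℝ => F (Function.update p.1 i p.2)) :=
      (hF.1.comp (measurable_update_pair i)).stronglyMeasurable
    exact this.integral_prod_right.measurable
  · obtain ⟨h1, K, hK⟩ := hF
    refine ⟨K, fun z => ?_⟩
    have := norm_integral_le_of_norm_le_const (μ := μ) (f := fun t => F (Function.update z i t))
      (C := K) (Filter.Eventually.of_forall fun t => hK _)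
    simp only [probReal_univ, mul_one] at this
    exact this

lemma integral_Ei {F : (ι → ℝ) → ℝ} (hF : BM F) (i : ι) :
    ∫ z, Ei μ i F z ∂(Measure.pi fun _ => μ) = ∫ z, F z ∂(Measure.pi fun _ => μ) := by
  have h := mp_update μ i
  rw [← h.map_eq, integral_map h.measurable.aemeasurable hF.1.aestronglyMeasurable]
  have hb : BM (fun p : (ι → ℝ) × ℝ => F (Function.update p.1 i p.2)) :=
    hF.comp (measurable_update_pair i)
  rw [integral_prod _ (hb.integrable _), h.map_eq]
  rfl

lemma Ei_dep {F : (ι → ℝ) → ℝ} {A : Set ι} (hF : DependsOn F A) (i : ι) :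
    DependsOn (Ei μ i F) (A \ {i}) := by
  intro x y h
  unfold Ei
  congr 1
  ext t
  apply hF
  intro j hj
  by_cases hji : j = i
  · subst hji; simp
  · simp only [Function.update_of_ne hji]
    exact h j ⟨hj, by simpa using hji⟩

lemma dep_update {F : (ι → ℝ) → ℝ} {A : Set ι} (hF : DependsOn F A) {i : ι} (hi : i ∉ A)
    (z : ι → ℝ) (t : ℝ) : F (Function.update z i t) = F z := by
  apply hF
  intro j hj
  rw [Function.update_of_ne]
  rintro rfl
  exact hi hj

lemma Ei_of_notMem {F : (ι → ℝ) → ℝ} {A : Set ι} (hF : DependsOn F A) {i : ι} (hi : i ∉ A) :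
    Ei μ i F = F := by
  ext z
  simp [Ei, dep_update hF hi]

/-- Independence: a function not depending on coordinate `i` times a function of coordinate `i`. -/
lemma integral_mul_coord {F : (ι → ℝ) → ℝ} (hF : BM F) {A : Set ι} (hd : DependsOn F A) {i : ι}
    (hi : i ∉ A) {ψ : ℝ → ℝ} (hψ : BM ψ) :
    ∫ z, F z * ψ (z i) ∂(Measure.pi fun _ => μ)
      = (∫ z, F z ∂(Measure.pi fun _ => μ)) * ∫ t, ψ t ∂μ := by
  rw [← integral_Ei μ (hF.mul (hψ.comp (measurable_pi_apply i))) i, ← integral_mul_const]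
  congr 1
  ext z
  simp only [Ei, dep_update hd hi, Function.update_self]
  rw [integral_const_mul]

/-- orthogonality: `∫ F * Ei G = ∫ Ei F * Ei G`. -/
lemma integral_mul_Ei {F G : (ι → ℝ) → ℝ} (hF : BM F) (hG : BM G) {A : Set ι}
    (hd : DependsOn G A) {i : ι} (hi : i ∉ A) :
    ∫ z, F z * G z ∂(Measure.pi fun _ => μ)
      = ∫ z, Ei μ i F z * G z ∂(Measure.pi fun _ => μ) := by
  rw [← integral_Ei μ (hF.mul hG) i]
  congr 1
  ext z
  simp only [Ei, dep_update hd hi]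
  rw [integral_mul_const]

lemma integral_sq_Ei {F : (ι → ℝ) → ℝ} (hF : BM F) (i : ι) :
    ∫ z, (F z) ^ 2 ∂(Measure.pi fun _ => μ)
      = ∫ z, (Ei μ i F z) ^ 2 ∂(Measure.pi fun _ => μ)
        + ∫ z, (F z - Ei μ i F z) ^ 2 ∂(Measure.pi fun _ => μ) := by
  have hE := hF.Ei μ i
  have h := integral_mul_Ei μ (i := i) hF hE
    (Ei_dep μ (dependsOn_univ F) i) (by simp)
  have e1 : ∀ z, (F z - Ei μ i F z) ^ 2
      = (F z) ^ 2 + (-2) * (F z * Ei μ i F z) + (Ei μ i F z) ^ 2 := fun z => by ring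
  simp_rw [e1]
  rw [integral_add (((hF.pow 2).add ((BM.const _).mul (hF.mul hE))).integrable _)
      ((hE.pow 2).integrable _),
    integral_add ((hF.pow 2).integrable _) (((BM.const _).mul (hF.mul hE)).integrable _),
    integral_const_mul, h]
  simp only [pow_two]
  ring

/-- The variance inequality for families of functions depending on few coordinates. -/
lemma variance_family {J : Type*} [Fintype J] (A : J → Set ι) (d : ℕ)
    (hd : ∀ i : ι, Nat.card {j : J // i ∈ A j} ≤ d) (T : Finset ι) :
    ∀ (f : (ι → ℝ) → ℝ) (s : J → (ι → ℝ) → ℝ), BM f → (∀ j, BM (s j)) →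
      DependsOn f (T : Set ι) → (∀ j, DependsOn (s j) (A j)) →
      ((Fintype.card J : ℝ) - d) * (∫ z, (f z) ^ 2 ∂(Measure.pi fun _ => μ)
          - (∫ z, f z ∂(Measure.pi fun _ => μ)) ^ 2)
        ≤ ∑ j, ∫ z, (f z - s j z) ^ 2 ∂(Measure.pi fun _ => μ) := by
  classical
  induction T using Finset.induction_on with
  | empty =>
    intro f s hf hs hfd hsd
    have hc : ∀ z, f z = f 0 := fun z => hfd (by simp)
    have : ∫ z, (f z) ^ 2 ∂(Measure.pi fun _ => μ)
          - (∫ z, f z ∂(Measure.pi fun _ => μ)) ^ 2 = 0 := by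
      simp_rw [hc]; simp
    rw [this, mul_zero]
    exact Finset.sum_nonneg fun j _ => integral_nonneg fun z => sq_nonneg _
  | insert i T hi ih =>
    intro f s hf hs hfd hsd
    have h1 := ih (Ei μ i f) (fun j => Ei μ i (s j)) (hf.Ei μ i) (fun j => (hs j).Ei μ i)
      ((Ei_dep μ hfd i).mono (by intro x; simp; tauto))
      (fun j => (Ei_dep μ (hsd j) i).mono Set.sdiff_subset)
    rw [integral_Ei μ hf] at h1
    have h2 := integral_sq_Ei μ hf i
    set D := ∫ z, (f z - Ei μ i f z) ^ 2 ∂(Measure.pi fun _ => μ) with hD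
    have hD0 : 0 ≤ D := integral_nonneg fun z => sq_nonneg _
    have key : ∀ j, ∫ z, (Ei μ i f z - Ei μ i (s j) z) ^ 2 ∂(Measure.pi fun _ => μ)
        + (if i ∈ A j then 0 else D) ≤ ∫ z, (f z - s j z) ^ 2 ∂(Measure.pi fun _ => μ) := by
      intro j
      have hlin : ∀ z, Ei μ i (fun z => f z - s j z) z = Ei μ i f z - Ei μ i (s j) z := by
        intro z
        exact integral_sub ((hf.update i z).integrable _) (((hs j).update i z).integrable _)
      have h3 := integral_sq_Ei μ (hf.sub (hs j)) i
      simp_rw [hlin] at h3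
      rw [h3]
      gcongr
      split_ifs with hij
      · exact integral_nonneg fun z => sq_nonneg _
      · rw [hD, Ei_of_notMem μ (hsd j) hij]
        simp
    have hcount : ((Fintype.card J : ℝ) - d) * D ≤ ∑ j, (if i ∈ A j then 0 else D) := by
      have : ∑ j, (if i ∈ A j then 0 else D)
          = ((Finset.univ.filter fun j => ¬ i ∈ A j).card : ℝ) * D := by
        rw [← nsmul_eq_mul, ← Finset.sum_const, Finset.sum_filter]
        apply Finset.sum_congr rfl
        intro j _
        split_ifs <;> simp_all
      rw [this]
      apply mul_le_mul_of_nonneg_right _ hD0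
      have hdi := hd i
      rw [Nat.card_eq_fintype_card, Fintype.card_subtype] at hdi
      have := Finset.card_filter_add_card_filter_not (s := (Finset.univ : Finset J)) (fun j => i ∈ A j)
      rw [Finset.card_univ] at this
      have h' : (Fintype.card J : ℝ) = (Finset.univ.filter fun j => i ∈ A j).card
        + (Finset.univ.filter fun j => ¬ i ∈ A j).card := by exact_mod_cast this.symm
      have h'' : ((Finset.univ.filter fun j => i ∈ A j).card : ℝ) ≤ d := by exact_mod_cast hdi
      linarith
    have h4 := Finset.sum_le_sum fun j (_ : j ∈ Finset.univ) => key j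
    rw [Finset.sum_add_distrib] at h4
    rw [h2]
    nlinarith

end Marginal



/-! ### Symmetric channels with a density and sign codes -/

/-- `PZ` has density `1 + g` with respect to the symmetric law `lam`, with `g` odd. -/
structure Chan (PZ lam : Measure ℝ) (g : ℝ → ℝ) : Prop where
  prob : IsProbabilityMeasure lam
  symm : MeasurePreserving (fun y : ℝ => -y) lam lam
  meas : Measurable g
  bdd : ∀ y, |g y| ≤ 1
  odd : ∀ y, g (-y) = - g y
  dens : PZ = lam.withDensity (fun y => ENNReal.ofReal (1 + g y))

/-- A nonempty set of sign vectors closed under multiplication. -/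
structure SCode {ι : Type*} (C : Finset (ι → ℝ)) : Prop where
  pm : ∀ x ∈ C, ∀ i, x i = 1 ∨ x i = -1
  mul : ∀ x ∈ C, ∀ y ∈ C, x * y ∈ C
  ne : C.Nonempty

section CodeLemmas

variable {ι : Type*} [Fintype ι] [DecidableEq ι]

/-- Likelihood of the coordinates in `S`. -/
noncomputable def wS (g : ℝ → ℝ) (S : Finset ι) (x y : ι → ℝ) : ℝ := ∏ i ∈ S, (1 + x i * g (y i))

/-- Averaged likelihood with coefficients `c`. -/
noncomputable def AA (C : Finset (ι → ℝ)) (g : ℝ → ℝ) (c : (ι → ℝ) → ℝ) (S : Finset ι)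
    (y : ι → ℝ) : ℝ :=
  (C.card : ℝ)⁻¹ * ∑ x ∈ C, c x * wS g S x y

/-- Extrinsic posterior mean of `x o`. -/
noncomputable def ff (C : Finset (ι → ℝ)) (g : ℝ → ℝ) (o : ι) (y : ι → ℝ) : ℝ :=
  AA C g (fun x => x o) (Finset.univ.erase o) y / AA C g (fun _ => 1) (Finset.univ.erase o) y

variable {PZ lam : Measure ℝ} {g : ℝ → ℝ} {C : Finset (ι → ℝ)}

lemma Chan.bm (h : Chan PZ lam g) : BM g := ⟨h.meas, 1, h.bdd⟩

lemma pi_withDensity_eq [IsProbabilityMeasure PZ] (h : Chan PZ lam g) :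
    (Measure.pi fun _ : ι => PZ) = (Measure.pi fun _ : ι => lam).withDensity
      (fun y => ∏ i, ENNReal.ofReal (1 + g (y i))) := by
  have := h.prob
  apply Measure.pi_eq
  intro s hs
  have hm : Measurable (fun y => ENNReal.ofReal (1 + g y)) :=
    ENNReal.measurable_ofReal.comp (measurable_const.add h.meas)
  rw [withDensity_apply _ (MeasurableSet.univ_pi hs),
    ← lintegral_indicator (MeasurableSet.univ_pi hs)]
  have e1 : ∀ y : ι → ℝ, (Set.univ.pi s).indicator
      (fun y => ∏ i, ENNReal.ofReal (1 + g (y i))) y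
      = ∏ i, (s i).indicator (fun y => ENNReal.ofReal (1 + g y)) (y i) := by
    intro y
    by_cases hy : y ∈ Set.univ.pi s
    · rw [Set.indicator_of_mem hy]
      apply Finset.prod_congr rfl
      intro i _
      rw [Set.indicator_of_mem (hy i (Set.mem_univ i))]
    · rw [Set.indicator_of_notMem hy]
      simp only [Set.mem_pi, not_forall, Set.mem_univ, true_implies] at hy
      obtain ⟨i, hi⟩ := hy
      symm
      apply Finset.prod_eq_zero (Finset.mem_univ i)
      rw [Set.indicator_of_notMem hi]
  simp_rw [e1]
  have hind := iIndepFun_pi (μ := fun _ : ι => lam)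
    (X := fun i => (s i).indicator (fun y => ENNReal.ofReal (1 + g y)))
    (fun i => (hm.indicator (hs i)).aemeasurable)
  rw [lintegral_prod_eq_prod_lintegral_of_indepFun Finset.univ _ hind
    (fun i => (hm.indicator (hs i)).comp (measurable_pi_apply i))]
  apply Finset.prod_congr rfl
  intro i _
  have hp := measurePreserving_eval (fun _ : ι => lam) i
  have h2 := hp.lintegral_comp (hm.indicator (hs i))
  rw [show (∫⁻ a, (s i).indicator (fun y => ENNReal.ofReal (1 + g y)) (a i)
      ∂(Measure.pi fun _ : ι => lam)) = _ from h2, lintegral_indicator (hs i),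
    ← withDensity_apply _ (hs i), ← h.dens]

lemma wS_nonneg (h : Chan PZ lam g) {x : ι → ℝ} (hx : ∀ i, x i = 1 ∨ x i = -1) (S : Finset ι)
    (y : ι → ℝ) : 0 ≤ wS g S x y := by
  apply Finset.prod_nonneg
  intro i _
  have := abs_le.1 (h.bdd (y i))
  rcases hx i with h | h <;> rw [h] <;> linarith

lemma BM_wS (h : Chan PZ lam g) (S : Finset ι) (x : ι → ℝ) : BM (wS g S x) :=
  BM.prod S fun i => (BM.const _).add ((BM.const _).mul (h.bm.comp (measurable_pi_apply i)))

lemma BM_AA (h : Chan PZ lam g) (c : (ι → ℝ) → ℝ) (S : Finset ι) : BM (AA C g c S) :=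
  (BM.const _).mul (BM.sum C fun x => (BM.const _).mul (BM_wS h S x))

lemma wS_dep (S : Finset ι) (x : ι → ℝ) : DependsOn (wS g S x) (S : Set ι) := by
  intro y y' hy
  apply Finset.prod_congr rfl
  intro i hi
  rw [hy i hi]

lemma AA_dep (c : (ι → ℝ) → ℝ) (S : Finset ι) : DependsOn (AA C g c S) (S : Set ι) := by
  intro y y' hy
  unfold AA
  congr 1
  apply Finset.sum_congr rfl
  intro x _
  rw [wS_dep S x hy]

lemma AA_insert (c : (ι → ℝ) → ℝ) {S : Finset ι} {k : ι} (hk : k ∉ S) (y : ι → ℝ) :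
    AA C g c (insert k S) y = AA C g c S y + g (y k) * AA C g (fun x => c x * x k) S y := by
  unfold AA
  rw [mul_left_comm, ← mul_add]
  congr 1
  rw [Finset.mul_sum, ← Finset.sum_add_distrib]
  apply Finset.sum_congr rfl
  intro x _
  unfold wS
  rw [Finset.prod_insert hk]
  ring

lemma abs_AA_le (h : Chan PZ lam g) (hC : SCode C) {c : (ι → ℝ) → ℝ} (hc : ∀ x ∈ C, |c x| ≤ 1)
    (S : Finset ι) (y : ι → ℝ) : |AA C g c S y| ≤ AA C g (fun _ => 1) S y := by
  unfold AA
  rw [abs_mul, abs_of_nonneg (by positivity : (0 : ℝ) ≤ (C.card : ℝ)⁻¹)]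
  gcongr
  refine (Finset.abs_sum_le_sum_abs _ _).trans (Finset.sum_le_sum fun x hx => ?_)
  rw [abs_mul, abs_of_nonneg (wS_nonneg h (hC.pm x hx) S y)]
  exact mul_le_mul_of_nonneg_right (hc x hx) (wS_nonneg h (hC.pm x hx) S y)

lemma AA_one_nonneg (h : Chan PZ lam g) (hC : SCode C) (S : Finset ι) (y : ι → ℝ) :
    0 ≤ AA C g (fun _ => 1) S y :=
  (abs_nonneg _).trans (abs_AA_le h hC (c := fun _ => 1) (by simp) S y)

lemma SCode.abs_le (hC : SCode C) {x : ι → ℝ} (hx : x ∈ C) (i : ι) : |x i| ≤ 1 := by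
  rcases hC.pm x hx i with h | h <;> simp [h]

lemma SCode.sq (hC : SCode C) {x : ι → ℝ} (hx : x ∈ C) (i : ι) : x i * x i = 1 := by
  rcases hC.pm x hx i with h | h <;> simp [h]

lemma SCode.sum_mul (hC : SCode C) {x₀ : ι → ℝ} (hx₀ : x₀ ∈ C) (F : (ι → ℝ) → ℝ) :
    ∑ x ∈ C, F (x₀ * x) = ∑ x ∈ C, F x := by
  have inv : ∀ a, x₀ * (x₀ * a) = a := by
    intro a
    ext i
    simp only [Pi.mul_apply, ← mul_assoc, hC.sq hx₀ i, one_mul]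
  exact Finset.sum_bij' (fun a _ => x₀ * a) (fun a _ => x₀ * a) (fun a ha => hC.mul _ hx₀ _ ha)
    (fun a ha => hC.mul _ hx₀ _ ha) (fun a _ => inv a) (fun a _ => inv a) (fun a _ => rfl)

lemma wS_mul (h : Chan PZ lam g) {x₀ : ι → ℝ} (hx₀ : ∀ i, x₀ i = 1 ∨ x₀ i = -1)
    (S : Finset ι) (x y : ι → ℝ) : wS g S x (x₀ * y) = wS g S (x₀ * x) y := by
  apply Finset.prod_congr rfl
  intro i _
  simp only [Pi.mul_apply]
  rcases hx₀ i with h' | h' <;> simp [h', h.odd]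

lemma AA_equiv (h : Chan PZ lam g) (hC : SCode C) {x₀ : ι → ℝ} (hx₀ : x₀ ∈ C)
    {c : (ι → ℝ) → ℝ} {ε : ℝ} (hc : ∀ x, c x = ε * c (x₀ * x)) (S : Finset ι) (y : ι → ℝ) :
    AA C g c S (x₀ * y) = ε * AA C g c S y := by
  unfold AA
  rw [mul_left_comm, ← hC.sum_mul hx₀ (fun x => c x * wS g S x y)]
  congr 1
  rw [Finset.mul_sum]
  apply Finset.sum_congr rfl
  intro x _
  rw [wS_mul h (hC.pm _ hx₀), hc x, mul_assoc]

lemma ff_equiv (h : Chan PZ lam g) (hC : SCode C) {x₀ : ι → ℝ} (hx₀ : x₀ ∈ C) (o : ι)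
    (y : ι → ℝ) : ff C g o (x₀ * y) = x₀ o * ff C g o y := by
  unfold ff
  rw [AA_equiv h hC hx₀ (ε := x₀ o), AA_equiv h hC hx₀ (ε := 1), one_mul, mul_div_assoc]
  · intro x; simp
  · intro x
    rw [Pi.mul_apply, ← mul_assoc, hC.sq hx₀, one_mul]

lemma abs_ff_le (h : Chan PZ lam g) (hC : SCode C) (o : ι) (y : ι → ℝ) : |ff C g o y| ≤ 1 := by
  unfold ff
  rw [abs_div, abs_of_nonneg (AA_one_nonneg h hC _ y)]
  exact div_le_one_of_le₀ (abs_AA_le h hC (fun x hx => hC.abs_le hx o) _ y)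
    (AA_one_nonneg h hC _ y)

lemma BM_ff (h : Chan PZ lam g) (hC : SCode C) (o : ι) : BM (ff C g o) :=
  ⟨(BM_AA h _ _).1.div (BM_AA h _ _).1, 1, abs_ff_le h hC o⟩

lemma ff_dep (o : ι) : DependsOn (ff C g o) ({o}ᶜ : Set ι) := by
  intro y y' hy
  unfold ff
  rw [AA_dep _ _ (y := y'), AA_dep (fun _ => 1) _ (y := y')] <;>
  · intro i hi
    apply hy
    simpa using hi

lemma ff_mul (h : Chan PZ lam g) (hC : SCode C) (o : ι) (y : ι → ℝ) :
    ff C g o y * AA C g (fun _ => 1) (Finset.univ.erase o) y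
      = AA C g (fun x => x o) (Finset.univ.erase o) y := by
  unfold ff
  by_cases h0 : AA C g (fun _ => 1) (Finset.univ.erase o) y = 0
  · have := abs_AA_le h hC (fun x hx => hC.abs_le hx o) (Finset.univ.erase o) y
    rw [h0] at this
    rw [h0, abs_nonpos_iff.1 this]; simp
  · rw [div_mul_cancel₀ _ h0]

lemma integral_flip (h : Chan PZ lam g) {x₀ : ι → ℝ} (hx₀ : ∀ i, x₀ i = 1 ∨ x₀ i = -1)
    {F : (ι → ℝ) → ℝ} (hF : BM F) :
    ∫ y, F (x₀ * y) ∂(Measure.pi fun _ => lam) = ∫ y, F y ∂(Measure.pi fun _ => lam) := by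
  have := h.prob
  have hmp : MeasurePreserving (fun (y : ι → ℝ) i => x₀ i * y i) (Measure.pi fun _ => lam)
      (Measure.pi fun _ => lam) := by
    apply measurePreserving_pi (fun _ => lam) (fun _ => lam) (f := fun i t => x₀ i * t)
    intro i
    rcases hx₀ i with h' | h'
    · simp only [h', one_mul]
      exact MeasurePreserving.id lam
    · simpa [h'] using h.symm
  have e := integral_map (μ := Measure.pi fun _ => lam) hmp.measurable.aemeasurable (f := F) hF.1.aestronglyMeasurable
  rw [hmp.map_eq] at e
  rw [e]
  rfl

lemma integral_g (h : Chan PZ lam g) : ∫ t, g t ∂lam = 0 := by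
  have e := integral_map (μ := lam) h.symm.measurable.aemeasurable (f := g) h.meas.aestronglyMeasurable
  rw [h.symm.map_eq] at e
  simp only [h.odd, integral_neg] at e
  linarith

lemma integral_mul_g (h : Chan PZ lam g) {F : (ι → ℝ) → ℝ} (hF : BM F) {A : Set ι}
    (hd : DependsOn F A) {i : ι} (hi : i ∉ A) :
    ∫ z, F z * g (z i) ∂(Measure.pi fun _ => lam) = 0 := by
  have := h.prob
  rw [integral_mul_coord lam hF hd hi h.bm, integral_g h, mul_zero]

/-- Change of measure. -/
lemma integral_pi_PZ [IsProbabilityMeasure PZ] (h : Chan PZ lam g) {F : (ι → ℝ) → ℝ} :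
    ∫ z, F z ∂(Measure.pi fun _ => PZ)
      = ∫ y, wS g Finset.univ 1 y * F y ∂(Measure.pi fun _ => lam) := by
  have := h.prob
  rw [pi_withDensity_eq h, integral_withDensity_eq_integral_toReal_smul]
  · congr 1
    ext y
    rw [smul_eq_mul, ENNReal.toReal_prod]
    congr 1
    apply Finset.prod_congr rfl
    intro i _
    rw [ENNReal.toReal_ofReal]
    · simp
    · linarith [abs_le.1 (h.bdd (y i))]
  · exact Finset.measurable_prod _ fun i _ => ENNReal.measurable_ofReal.comp
      (measurable_const.add (h.meas.comp (measurable_pi_apply i)))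
  · exact Filter.Eventually.of_forall fun y => ENNReal.prod_lt_top fun i _ => ENNReal.ofReal_lt_top

/-- Averaging over the code: expectation of `F` transforming with the character `c`. -/
lemma integral_avg [IsProbabilityMeasure PZ] (h : Chan PZ lam g) (hC : SCode C)
    {F : (ι → ℝ) → ℝ} (hF : BM F) {c : (ι → ℝ) → ℝ}
    (hc : ∀ x ∈ C, ∀ y, F (x * y) = c x * F y) :
    ∫ z, F z ∂(Measure.pi fun _ => PZ)
      = ∫ y, AA C g c Finset.univ y * F y ∂(Measure.pi fun _ => lam) := by
  have := h.prob
  rw [integral_pi_PZ h]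
  have e : ∀ x ∈ C, ∫ y, (c x * wS g Finset.univ x y) * F y ∂(Measure.pi fun _ => lam)
      = ∫ y, wS g Finset.univ 1 y * F y ∂(Measure.pi fun _ => lam) := by
    intro x hx
    rw [← integral_flip h (hC.pm x hx) (F := fun y => wS g Finset.univ 1 y * F y)
      ((BM_wS h _ _).mul hF)]
    congr 1
    ext y
    rw [hc x hx, wS_mul h (hC.pm x hx), mul_one]
    ring
  unfold AA
  simp_rw [mul_assoc, Finset.sum_mul]
  rw [integral_const_mul, integral_finsetSum]
  · rw [Finset.sum_congr rfl e, Finset.sum_const, nsmul_eq_mul, ← mul_assoc, inv_mul_cancel₀, one_mul]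
    exact_mod_cast hC.ne.card_pos.ne'
  · intro x _
    exact (((BM.const _).mul (BM_wS h _ _)).mul hF).integrable _

/-- Same, dropping a coordinate on which `F` does not depend. -/
lemma integral_avg_erase [IsProbabilityMeasure PZ] (h : Chan PZ lam g) (hC : SCode C)
    {F : (ι → ℝ) → ℝ} (hF : BM F) {c : (ι → ℝ) → ℝ}
    (hc : ∀ x ∈ C, ∀ y, F (x * y) = c x * F y) (o : ι) (hd : DependsOn F ({o}ᶜ : Set ι)) :
    ∫ z, F z ∂(Measure.pi fun _ => PZ)
      = ∫ y, AA C g c (Finset.univ.erase o) y * F y ∂(Measure.pi fun _ => lam) := by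
  have := h.prob
  rw [integral_avg h hC hF hc]
  have e : ∀ y, AA C g c Finset.univ y * F y = AA C g c (Finset.univ.erase o) y * F y
      + (AA C g (fun x => c x * x o) (Finset.univ.erase o) y * F y) * g (y o) := by
    intro y
    have := AA_insert (C := C) (g := g) c (Finset.notMem_erase o Finset.univ) y
    rw [Finset.insert_erase (Finset.mem_univ o)] at this
    rw [this]; ring
  simp_rw [e]
  rw [integral_add (((BM_AA h _ _).mul hF).integrable _)
    ((((BM_AA h _ _).mul hF).mul (h.bm.comp (measurable_pi_apply o))).integrable _),
    integral_mul_g h (A := ({o}ᶜ : Set ι)) ((BM_AA h _ _).mul hF), add_zero]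
  · intro y y' hy
    simp only
    rw [hd hy, AA_dep _ _ (y := y')]
    intro i hi
    apply hy
    simpa using hi
  · simp

/-- The extrinsic posterior mean is the conditional expectation. -/
lemma integral_ff_mul [IsProbabilityMeasure PZ] (h : Chan PZ lam g) (hC : SCode C) (o : ι)
    {s : (ι → ℝ) → ℝ} (hs : BM s) (he : ∀ x ∈ C, ∀ y, s (x * y) = x o * s y)
    (hd : DependsOn s ({o}ᶜ : Set ι)) :
    ∫ z, ff C g o z * s z ∂(Measure.pi fun _ => PZ) = ∫ z, s z ∂(Measure.pi fun _ => PZ) := by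
  rw [integral_avg_erase h hC hs (c := fun x => x o) he o hd,
    integral_avg_erase h hC ((BM_ff h hC o).mul hs) (c := fun _ => 1) _ o]
  · congr 1
    ext y
    rw [← ff_mul h hC]
    ring
  · intro y y' hy
    simp only
    rw [hd hy, ff_dep o hy]
  · intro x hx y
    rw [ff_equiv h hC hx, he x hx, one_mul]
    linear_combination (ff C g o y * s y) * hC.sq hx o

/-- The overlap. -/
noncomputable def qq (PZ : Measure ℝ) (C : Finset (ι → ℝ)) (g : ℝ → ℝ) (o : ι) : ℝ :=
  ∫ z, ff C g o z ∂(Measure.pi fun _ => PZ)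

lemma integral_ff_sq [IsProbabilityMeasure PZ] (h : Chan PZ lam g) (hC : SCode C) (o : ι) :
    ∫ z, (ff C g o z) ^ 2 ∂(Measure.pi fun _ => PZ) = qq PZ C g o := by
  simp_rw [pow_two]
  exact integral_ff_mul h hC o (BM_ff h hC o) (fun x hx y => ff_equiv h hC hx o y) (ff_dep o)

lemma qq_nonneg [IsProbabilityMeasure PZ] (h : Chan PZ lam g) (hC : SCode C) (o : ι) :
    0 ≤ qq PZ C g o := by
  rw [← integral_ff_sq h hC o]
  exact integral_nonneg fun z => sq_nonneg _

lemma qq_le_one [IsProbabilityMeasure PZ] (h : Chan PZ lam g) (hC : SCode C) (o : ι) :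
    qq PZ C g o ≤ 1 := by
  have : qq PZ C g o ≤ ∫ z : ι → ℝ, (1 : ℝ) ∂(Measure.pi fun _ => PZ) := by
    apply integral_mono ((BM_ff h hC o).integrable _) ((BM.const 1).integrable _)
    intro z
    exact (abs_le.1 (abs_ff_le h hC o z)).2
  simpa using this

/-- `∫ |B| ≤ √q`. -/
lemma integral_abs_B_le [IsProbabilityMeasure PZ] (h : Chan PZ lam g) (hC : SCode C) (o : ι) :
    ∫ y, |AA C g (fun x => x o) (Finset.univ.erase o) y| ∂(Measure.pi fun _ => lam)
      ≤ Real.sqrt (qq PZ C g o) := by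
  have e : ∀ y, |AA C g (fun x => x o) (Finset.univ.erase o) y|
      = AA C g (fun _ => 1) (Finset.univ.erase o) y * |ff C g o y| := by
    intro y
    rw [← ff_mul h hC, abs_mul, abs_of_nonneg (AA_one_nonneg h hC _ y), mul_comm]
  simp_rw [e]
  rw [← integral_avg_erase h hC (BM_ff h hC o).abs (c := fun _ => 1) _ o]
  · apply Real.le_sqrt_of_sq_le
    rw [← integral_ff_sq h hC o]
    set a := ∫ z, |ff C g o z| ∂(Measure.pi fun _ => PZ)
    have : 0 ≤ ∫ z, (|ff C g o z| - a) ^ 2 ∂(Measure.pi fun _ => PZ) :=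
      integral_nonneg fun z => sq_nonneg _
    have e2 : ∀ z, (|ff C g o z| - a) ^ 2 = (ff C g o z) ^ 2 - (2 * a) * |ff C g o z| + a ^ 2 := by
      intro z; rw [sub_sq, sq_abs]; ring
    simp_rw [e2] at this
    have hb := BM_ff h hC o
    rw [integral_add (((hb.pow 2).sub ((BM.const _).mul hb.abs)).integrable _)
      ((BM.const _).integrable _), integral_sub ((hb.pow 2).integrable _)
      (((BM.const _).mul hb.abs).integrable _), integral_const_mul] at this
    simp only [integral_const, probReal_univ, smul_eq_mul, one_mul] at this
    nlinarith
  · intro y y' hy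
    simp only
    rw [ff_dep o hy]
  · intro x hx y
    rw [ff_equiv h hC hx, abs_mul, one_mul]
    rcases hC.pm x hx o with h' | h' <;> simp [h']

end CodeLemmas



/-! ### The entropy inequality -/

lemma BM.cont {α : Type*} [MeasurableSpace α] {F : α → ℝ} (hF : BM F) {φ : ℝ → ℝ}
    (hφ : Continuous φ) : BM (fun x => φ (F x)) := by
  obtain ⟨h1, K, hK⟩ := hF
  obtain ⟨B, hB⟩ := (isCompact_Icc (a := -K) (b := K)).exists_bound_of_continuousOn hφ.continuousOn
  exact ⟨hφ.measurable.comp h1, B, fun x => hB _ (abs_le.1 (hK x))⟩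

/-- `x log x`. -/
noncomputable def eta (x : ℝ) : ℝ := x * Real.log x

lemma continuous_eta : Continuous eta := Real.continuous_mul_log

lemma eta_mul (a b : ℝ) : eta (a * b) = a * eta b + b * eta a := by
  unfold eta
  by_cases ha : a = 0
  · simp [ha]
  by_cases hb : b = 0
  · simp [hb]
  rw [Real.log_mul ha hb]
  ring

lemma eta_aux {a b u : ℝ} (hb : 0 ≤ b) (hba : b ≤ a) (hu : |u| ≤ 1) :
    eta (a + b * u) ≤ eta a + u * (b * Real.log a) + b * eta (1 + u) := by
  have hu' := abs_le.1 hu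
  rcases eq_or_lt_of_le (hb.trans hba) with h0 | h0
  · have : b = 0 := by linarith
    simp [this]
  have h1 : 0 ≤ 1 - b / a := by rw [sub_nonneg]; exact div_le_one_of_le₀ hba h0.le
  have h2 : 0 ≤ b / a := by positivity
  have hconv := Real.convexOn_mul_log.2 (Set.mem_Ici.2 h0.le)
    (Set.mem_Ici.2 (mul_nonneg h0.le (by linarith) : (0:ℝ) ≤ a * (1 + u))) h1 h2 (by ring)
  simp only [smul_eq_mul] at hconv
  have e1 : (1 - b / a) * a + b / a * (a * (1 + u)) = a + b * u := by field_simp; ring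
  rw [e1] at hconv
  have e2 := eta_mul a (1 + u)
  change eta (a + b * u) ≤ (1 - b / a) * eta a + b / a * eta (a * (1 + u)) at hconv
  rw [e2] at hconv
  refine hconv.trans (le_of_eq ?_)
  have e3 : eta a = a * Real.log a := rfl
  rw [e3]
  field_simp
  ring

lemma eta_ineq {a b u : ℝ} (hba : |b| ≤ a) (hu : |u| ≤ 1) :
    eta (a + b * u) ≤ eta a + (b * Real.log a) * u
      + |b| * ((eta (1 + u) + eta (1 - u)) / 2) + b * ((eta (1 + u) - eta (1 - u)) / 2) := by
  rcases le_total 0 b with hb | hb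
  · rw [abs_of_nonneg hb] at *
    have := eta_aux hb hba hu
    linarith
  · rw [abs_of_nonpos hb] at *
    have := eta_aux (b := -b) (u := -u) (by linarith) hba (by rwa [abs_neg])
    rw [neg_mul_neg] at this
    rw [show (1 : ℝ) + -u = 1 - u by ring] at this
    linarith

section Entropy

variable {ι : Type*} [Fintype ι] [DecidableEq ι]
variable {PZ lam : Measure ℝ} {g : ℝ → ℝ} {C : Finset (ι → ℝ)}

/-- Capacity in nats. -/
noncomputable def kap (lam : Measure ℝ) (g : ℝ → ℝ) : ℝ := ∫ t, eta (1 + g t) ∂lam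

lemma BM_zeta (h : Chan PZ lam g) : BM (fun t => eta (1 + g t)) :=
  ((BM.const 1).add h.bm).cont continuous_eta

lemma BM_zeta' (h : Chan PZ lam g) : BM (fun t => eta (1 - g t)) :=
  ((BM.const 1).sub h.bm).cont continuous_eta

lemma kap_neg (h : Chan PZ lam g) : ∫ t, eta (1 - g t) ∂lam = kap lam g := by
  have e := integral_map (μ := lam) h.symm.measurable.aemeasurable (f := fun t => eta (1 + g t))
    (BM_zeta h).1.aestronglyMeasurable
  rw [h.symm.map_eq] at e
  rw [kap, e]
  simp only [h.odd, ← sub_eq_add_neg]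

lemma entropy_step (h : Chan PZ lam g) (hC : SCode C) {S : Finset ι} {k : ι} (hk : k ∉ S) :
    ∫ y, eta (AA C g (fun _ => 1) (insert k S) y) ∂(Measure.pi fun _ => lam)
      ≤ ∫ y, eta (AA C g (fun _ => 1) S y) ∂(Measure.pi fun _ => lam)
        + kap lam g * ∫ y, |AA C g (fun x => x k) S y| ∂(Measure.pi fun _ => lam) := by
  have := h.prob
  set L := AA C g (fun _ => 1) S with hL
  set B := AA C g (fun x => x k) S with hB
  have bL : BM L := BM_AA h _ _
  have bB : BM B := BM_AA h _ _
  have dL : DependsOn L (S : Set ι) := AA_dep _ _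
  have dB : DependsOn B (S : Set ι) := AA_dep _ _
  have hk' : k ∉ (S : Set ι) := by simpa using hk
  have hBL : ∀ y, |B y| ≤ L y := abs_AA_le h hC (fun x hx => hC.abs_le hx k) S
  have bE : BM (fun y => eta (L y)) := bL.cont continuous_eta
  have bG : BM (fun y => B y * Real.log (L y)) := by
    refine ⟨bB.1.mul (Real.measurable_log.comp bL.1), ?_⟩
    obtain ⟨K, hK⟩ := bE.2
    refine ⟨K, fun y => le_trans ?_ (hK y)⟩
    unfold eta
    rw [abs_mul, abs_mul]
    exact mul_le_mul_of_nonneg_right ((hBL y).trans (le_abs_self _)) (abs_nonneg _)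
  have dG : DependsOn (fun y => B y * Real.log (L y)) (S : Set ι) := by
    intro y y' hy
    simp only
    rw [dL hy, dB hy]
  have bz1 : BM (fun t => (eta (1 + g t) + eta (1 - g t)) / 2) := by
    simpa only [div_eq_mul_inv] using ((BM_zeta h).add (BM_zeta' h)).mul (BM.const 2⁻¹)
  have bz2 : BM (fun t => (eta (1 + g t) - eta (1 - g t)) / 2) := by
    simpa only [div_eq_mul_inv] using ((BM_zeta h).sub (BM_zeta' h)).mul (BM.const 2⁻¹)
  have iz1 : ∫ t, (eta (1 + g t) + eta (1 - g t)) / 2 ∂lam = kap lam g := by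
    rw [integral_div, integral_add ((BM_zeta h).integrable _) ((BM_zeta' h).integrable _),
      kap_neg h, kap]
    ring
  have iz2 : ∫ t, (eta (1 + g t) - eta (1 - g t)) / 2 ∂lam = 0 := by
    rw [integral_div, integral_sub ((BM_zeta h).integrable _) ((BM_zeta' h).integrable _),
      kap_neg h, kap]
    ring
  have hpt : ∀ y, eta (AA C g (fun _ => 1) (insert k S) y) ≤ eta (L y)
      + (B y * Real.log (L y)) * g (y k)
      + |B y| * ((eta (1 + g (y k)) + eta (1 - g (y k))) / 2)
      + B y * ((eta (1 + g (y k)) - eta (1 - g (y k))) / 2) := by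
    intro y
    rw [AA_insert _ hk y]
    simp only [one_mul]
    rw [mul_comm (g (y k))]
    exact eta_ineq (hBL y) (h.bdd _)
  have b2 := bG.mul (h.bm.comp (measurable_pi_apply k))
  have b3 := bB.abs.mul (bz1.comp (measurable_pi_apply k))
  have b4 := bB.mul (bz2.comp (measurable_pi_apply k))
  refine (integral_mono (((BM_AA h _ _).cont continuous_eta).integrable _)
    ((((bE.add b2).add b3).add b4).integrable _) hpt).trans (le_of_eq ?_)
  rw [integral_add (((bE.add b2).add b3).integrable _) (b4.integrable _),
    integral_add ((bE.add b2).integrable _) (b3.integrable _),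
    integral_add (bE.integrable _) (b2.integrable _),
    integral_mul_g h bG dG hk', integral_mul_coord lam bB dB hk' bz2, iz2,
    integral_mul_coord lam bB.abs (A := (S : Set ι)) _ hk' bz1, iz1]
  · ring
  · intro y y' hy
    simp only
    rw [dB hy]

lemma abs_AA_mono_insert (h : Chan PZ lam g) (c : (ι → ℝ) → ℝ) {S : Finset ι} {k : ι}
    (hk : k ∉ S) :
    ∫ y, |AA C g c S y| ∂(Measure.pi fun _ => lam)
      ≤ ∫ y, |AA C g c (insert k S) y| ∂(Measure.pi fun _ => lam) := by
  have := h.prob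
  set x₀ : ι → ℝ := Function.update 1 k (-1) with hx₀
  have hpm : ∀ i, x₀ i = 1 ∨ x₀ i = -1 := by
    intro i
    by_cases hi : i = k
    · subst hi; simp [hx₀]
    · simp [hx₀, hi]
  have hdep : ∀ (c : (ι → ℝ) → ℝ) y, AA C g c S (x₀ * y) = AA C g c S y := by
    intro c y
    apply AA_dep
    intro i hi
    have : i ≠ k := by rintro rfl; exact hk (by simpa using hi)
    simp [hx₀, this]
  have hpt : ∀ y, |AA C g c S y| ≤ (|AA C g c (insert k S) y| + |AA C g c (insert k S) (x₀ * y)|) / 2 := by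
    intro y
    have e : AA C g c S y = (AA C g c (insert k S) y + AA C g c (insert k S) (x₀ * y)) / 2 := by
      rw [AA_insert _ hk, AA_insert _ hk, hdep, hdep]
      have : (x₀ * y) k = - y k := by simp [hx₀]
      rw [this, h.odd]
      ring
    rw [e, abs_div, abs_two]
    gcongr
    exact abs_add_le _ _
  have b1 : BM (fun y => |AA C g c (insert k S) y|) := (BM_AA h _ _).abs
  have b2 : BM (fun y => |AA C g c (insert k S) (x₀ * y)|) := by
    apply b1.comp (e := fun y => x₀ * y)
    fun_prop
  refine (integral_mono ((BM_AA h _ _).abs.integrable _)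
    ((b1.integrable _).add (b2.integrable _) |>.div_const 2) hpt).trans (le_of_eq ?_)
  simp only [Pi.add_apply]
  rw [integral_div, integral_add (b1.integrable _) (b2.integrable _),
    integral_flip h hpm (F := fun y => |AA C g c (insert k S) y|) b1]
  ring

lemma abs_AA_mono (h : Chan PZ lam g) (c : (ι → ℝ) → ℝ) {S T : Finset ι} (hST : S ⊆ T) :
    ∫ y, |AA C g c S y| ∂(Measure.pi fun _ => lam)
      ≤ ∫ y, |AA C g c T y| ∂(Measure.pi fun _ => lam) := by
  have : ∀ U : Finset ι, ∫ y, |AA C g c S y| ∂(Measure.pi fun _ => lam)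
      ≤ ∫ y, |AA C g c (U ∪ S) y| ∂(Measure.pi fun _ => lam) := by
    intro U
    induction U using Finset.induction_on with
    | empty => simp
    | insert k U _ ih =>
      rw [Finset.insert_union]
      by_cases hk : k ∈ U ∪ S
      · rwa [Finset.insert_eq_of_mem hk]
      · exact ih.trans (abs_AA_mono_insert h c hk)
  have h2 := this T
  rwa [Finset.union_eq_left.2 hST] at h2

lemma entropy_upper (h : Chan PZ lam g) (hC : SCode C) (hκ : 0 ≤ kap lam g) (S : Finset ι) :
    ∫ y, eta (AA C g (fun _ => 1) S y) ∂(Measure.pi fun _ => lam)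
      ≤ kap lam g * ∑ i ∈ S,
        ∫ y, |AA C g (fun x => x i) (Finset.univ.erase i) y| ∂(Measure.pi fun _ => lam) := by
  induction S using Finset.induction_on with
  | empty =>
    have : ∀ y, AA C g (fun _ => 1) ∅ y = 1 := by
      intro y
      unfold AA wS
      have : (C.card : ℝ) ≠ 0 := by exact_mod_cast hC.ne.card_pos.ne'
      simp [this]
    simp [this, eta]
  | insert k S hk ih =>
    refine (entropy_step h hC hk).trans ?_
    rw [Finset.sum_insert hk, mul_add]
    have h3 : ∫ y, |AA C g (fun x => x k) S y| ∂(Measure.pi fun _ => lam)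
      ≤ ∫ y, |AA C g (fun x => x k) (Finset.univ.erase k) y| ∂(Measure.pi fun _ => lam) := by
      apply abs_AA_mono h
      intro i hi
      simp only [Finset.mem_erase, Finset.mem_univ, and_true]
      rintro rfl
      exact hk hi
    have := mul_le_mul_of_nonneg_left h3 hκ
    linarith

lemma integral_wS (h : Chan PZ lam g) {x : ι → ℝ} (hx : ∀ i, x i = 1 ∨ x i = -1) (S : Finset ι) :
    ∫ y, wS g S x y ∂(Measure.pi fun _ => lam) = 1 ∧
    ∫ y, eta (wS g S x y) ∂(Measure.pi fun _ => lam) = S.card * kap lam g := by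
  have := h.prob
  induction S using Finset.induction_on with
  | empty => simp [wS, eta]
  | insert k S hk ih =>
    have hk' : k ∉ (S : Set ι) := by simpa using hk
    have e : ∀ y, wS g (insert k S) x y = wS g S x y * (1 + x k * g (y k)) := by
      intro y
      unfold wS
      rw [Finset.prod_insert hk, mul_comm]
    have bw := BM_wS h S x
    have b1 : BM (fun t => 1 + x k * g t) := (BM.const _).add ((BM.const _).mul h.bm)
    have i1 : ∫ t, (1 + x k * g t) ∂lam = 1 := by
      rw [integral_add ((BM.const _).integrable _) (((BM.const _).mul h.bm).integrable _),
        integral_const_mul, integral_g h]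
      simp
    have b2 : BM (fun t => eta (1 + x k * g t)) := b1.cont continuous_eta
    have i2 : ∫ t, eta (1 + x k * g t) ∂lam = kap lam g := by
      rcases hx k with h' | h'
      · simp [h', kap]
      · simp only [h', neg_mul, one_mul, ← sub_eq_add_neg]
        exact kap_neg h
    simp_rw [e, eta_mul]
    refine ⟨?_, ?_⟩
    · rw [integral_mul_coord lam bw (wS_dep S x) hk' b1, ih.1, i1, one_mul]
    · have bw' : BM (fun y => eta (wS g S x y)) := bw.cont continuous_eta
      have e2 : ∀ y, wS g S x y * eta (1 + x k * g (y k)) + (1 + x k * g (y k)) * eta (wS g S x y)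
        = wS g S x y * eta (1 + x k * g (y k)) + eta (wS g S x y) * (1 + x k * g (y k)) := by
        intro y; ring
      simp_rw [e2]
      rw [integral_add ((bw.mul (b2.comp (measurable_pi_apply k))).integrable _)
        ((bw'.mul (b1.comp (measurable_pi_apply k))).integrable _),
        integral_mul_coord lam bw (wS_dep S x) hk' b2,
        integral_mul_coord lam bw' (A := (S : Set ι)) _ hk' b1, ih.1, ih.2, i1, i2,
        Finset.card_insert_of_notMem hk]
      · push_cast; ring
      · intro y y' hy
        simp only
        rw [wS_dep S x hy]

lemma entropy_lower (h : Chan PZ lam g) (hC : SCode C) :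
    (Fintype.card ι : ℝ) * kap lam g - Real.log C.card
      ≤ ∫ y, eta (AA C g (fun _ => 1) Finset.univ y) ∂(Measure.pi fun _ => lam) := by
  have := h.prob
  have hc : (0 : ℝ) < C.card := by exact_mod_cast hC.ne.card_pos
  have bm : ∀ x : ι → ℝ, BM (fun y : ι → ℝ => eta (wS g Finset.univ x y) - wS g Finset.univ x y * Real.log C.card) :=
    fun x => ((BM_wS h _ _).cont continuous_eta).sub ((BM_wS h _ _).mul (BM.const _))
  have hpt : ∀ y, (C.card : ℝ)⁻¹ * ∑ x ∈ C,
      (eta (wS g Finset.univ x y) - wS g Finset.univ x y * Real.log C.card)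
      ≤ eta (AA C g (fun _ => 1) Finset.univ y) := by
    intro y
    set a := AA C g (fun _ => 1) Finset.univ y with ha
    have e : eta a = (C.card : ℝ)⁻¹ * ∑ x ∈ C, wS g Finset.univ x y * Real.log a := by
      rw [← Finset.sum_mul, ← mul_assoc, eta]
      congr 1
      rw [ha, AA]
      simp
    rw [e]
    gcongr with x hx
    have hw := wS_nonneg h (hC.pm x hx) Finset.univ y
    rcases eq_or_lt_of_le hw with h0 | h0
    · simp [← h0, eta]
    · rw [eta, ← mul_sub, ← Real.log_div h0.ne' hc.ne']
      gcongr
      rw [ha, AA, div_eq_inv_mul]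
      gcongr
      simp only [one_mul]
      exact Finset.single_le_sum (f := fun x => wS g Finset.univ x y)
        (fun x hx => wS_nonneg h (hC.pm x hx) Finset.univ y) hx
  refine le_trans (le_of_eq ?_) (integral_mono (((BM.const _).mul (BM.sum C bm)).integrable _)
    (((BM_AA h _ _).cont continuous_eta).integrable _) hpt)
  rw [integral_const_mul, integral_finsetSum _ fun x _ => (bm x).integrable _]
  have e : ∀ x ∈ C, ∫ y, (eta (wS g Finset.univ x y) - wS g Finset.univ x y * Real.log C.card)
      ∂(Measure.pi fun _ => lam) = (Fintype.card ι : ℝ) * kap lam g - Real.log C.card := by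
    intro x hx
    have hw := integral_wS h (hC.pm x hx) Finset.univ
    rw [integral_sub (((BM_wS h _ _).cont continuous_eta).integrable _)
      (((BM_wS h _ _).mul (BM.const _)).integrable _), integral_mul_const, hw.1, hw.2,
      Finset.card_univ, one_mul]
  rw [Finset.sum_congr rfl e, Finset.sum_const, nsmul_eq_mul, ← mul_assoc,
    inv_mul_cancel₀ hc.ne', one_mul]

/-- The entropy bound: `N κ - log |C| ≤ κ ∑ ∫ |B_i|`. -/
lemma entropy_main (h : Chan PZ lam g) (hC : SCode C) (hκ : 0 ≤ kap lam g) :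
    (Fintype.card ι : ℝ) * kap lam g - Real.log C.card
      ≤ kap lam g * ∑ i,
        ∫ y, |AA C g (fun x => x i) (Finset.univ.erase i) y| ∂(Measure.pi fun _ => lam) :=
  (entropy_lower h hC).trans (entropy_upper h hC hκ Finset.univ)

/-- Transitivity: all `∫ |B_i|` agree. -/
lemma integral_abs_B_perm (h : Chan PZ lam g) (τ : Equiv.Perm ι) (hτ : ∀ x ∈ C, x ∘ τ ∈ C)
    (hτ2 : ∀ i, τ (τ i) = i) (i o : ι) (hio : τ i = o) :
    ∫ y, |AA C g (fun x => x i) (Finset.univ.erase i) y| ∂(Measure.pi fun _ => lam)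
      = ∫ y, |AA C g (fun x => x o) (Finset.univ.erase o) y| ∂(Measure.pi fun _ => lam) := by
  have := h.prob
  have hmp : MeasurePreserving (fun (y : ι → ℝ) => y ∘ τ) (Measure.pi fun _ => lam)
      (Measure.pi fun _ => lam) := by
    have := measurePreserving_piCongrLeft (fun _ : ι => lam) τ.symm
    convert this using 1
    ext y j
    simp [MeasurableEquiv.piCongrLeft, Equiv.piCongrLeft, Equiv.piCongrLeft']
  have e := integral_map (μ := Measure.pi fun _ => lam) hmp.measurable.aemeasurable
    (f := fun y => |AA C g (fun x => x o) (Finset.univ.erase o) y|)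
    (BM_AA h _ _).abs.1.aestronglyMeasurable
  rw [hmp.map_eq] at e
  rw [e]
  congr 1
  ext y
  congr 1
  unfold AA
  congr 1
  have inv : ∀ x : ι → ℝ, (x ∘ τ) ∘ τ = x := by
    intro x; ext j; simp [hτ2]
  refine Finset.sum_bij' (fun a _ => a ∘ τ) (fun a _ => a ∘ τ) hτ hτ (fun a _ => inv a)
    (fun a _ => inv a) (fun a _ => ?_)
  have hoi : τ o = i := by rw [← hio, hτ2]
  simp only [Function.comp_apply, hoi]
  congr 1
  unfold wS
  refine Finset.prod_bij' (fun j _ => τ j) (fun j _ => τ j) ?_ ?_ (fun j _ => hτ2 j)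
    (fun j _ => hτ2 j) (fun j _ => by simp [hτ2])
  · intro j hj
    simp only [Finset.mem_erase, Finset.mem_univ, and_true] at hj ⊢
    intro hh
    exact hj (by rw [← hτ2 j, hh, hoi])
  · intro j hj
    simp only [Finset.mem_erase, Finset.mem_univ, and_true] at hj ⊢
    intro hh
    exact hj (by rw [← hτ2 j, hh, hio])

end Entropy



/-! ### Existence of the density and the capacity -/

lemma exists_chan_aux (PZ : Measure ℝ) [IsProbabilityMeasure PZ] :
    ∃ (lam : Measure ℝ) (g : ℝ → ℝ), Chan PZ lam g := by
  have hneg : Measurable (fun y : ℝ => -y) := measurable_neg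
  set lam : Measure ℝ := (2 : ENNReal)⁻¹ • (PZ + PZ.map (fun y : ℝ => -y)) with hlam
  have hprob : IsProbabilityMeasure lam := by
    constructor
    have : IsProbabilityMeasure (PZ.map (fun y : ℝ => -y)) :=
      Measure.isProbabilityMeasure_map hneg.aemeasurable
    rw [hlam]
    simp only [Measure.smul_apply, Measure.add_apply, measure_univ, smul_eq_mul]
    rw [one_add_one_eq_two, ENNReal.inv_mul_cancel (by norm_num) (by norm_num)]
  have hinv : (PZ.map (fun y : ℝ => -y)).map (fun y : ℝ => -y) = PZ := by
    rw [Measure.map_map hneg hneg]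
    have : ((fun y : ℝ => -y) ∘ fun y : ℝ => -y) = id := by ext; simp
    rw [this, Measure.map_id]
  have hsymm : MeasurePreserving (fun y : ℝ => -y) lam lam := by
    refine ⟨hneg, ?_⟩
    rw [hlam, Measure.map_smul, Measure.map_add _ _ hneg, hinv, add_comm]
  have hac : PZ ≪ lam := by
    intro s hs
    rw [hlam] at hs
    simp only [Measure.smul_apply, Measure.add_apply, smul_eq_mul, mul_eq_zero] at hs
    rcases hs with h | h
    · simp at h
    · exact (add_eq_zero.1 h).1
  set p := PZ.rnDeriv lam with hp
  have hpm : Measurable p := Measure.measurable_rnDeriv _ _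
  have hd : lam.withDensity p = PZ := Measure.withDensity_rnDeriv_eq _ _ hac
  have hpm' : Measurable (fun y => p (-y)) := hpm.comp hneg
  have hd' : lam.withDensity (fun y => p (-y)) = PZ.map (fun y => -y) := by
    ext s hs
    rw [withDensity_apply _ hs, Measure.map_apply hneg hs, ← hd,
      withDensity_apply _ (hneg hs), ← hsymm.setLIntegral_comp_preimage hs hpm']
    simp only [neg_neg]
  have hsum : (fun y => p y + p (-y)) =ᵐ[lam] fun _ => 2 := by
    rw [← withDensity_eq_iff (by fun_prop) (by fun_prop)]
    · have : (fun y => p y + p (-y)) = p + fun y => p (-y) := rfl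
      rw [this, withDensity_add_left hpm, hd, hd', withDensity_const, hlam, smul_smul,
        ENNReal.mul_inv_cancel (by norm_num) (by norm_num), one_smul]
    · rw [lintegral_add_left hpm]
      have e1 : ∫⁻ y, p y ∂lam = PZ Set.univ := by rw [← hd]; simp
      have e2 : ∫⁻ y, p (-y) ∂lam = (PZ.map (fun y => -y)) Set.univ := by rw [← hd']; simp
      rw [e1, e2]
      exact ENNReal.add_ne_top.2 ⟨measure_ne_top _ _, measure_ne_top _ _⟩
  set g : ℝ → ℝ := fun y => max (-1) (min 1 (((p y).toReal - (p (-y)).toReal) / 2)) with hg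
  refine ⟨lam, g, hprob, hsymm, ?_, ?_, ?_, ?_⟩
  · exact measurable_const.max (measurable_const.min
      ((hpm.ennreal_toReal.sub hpm'.ennreal_toReal).div_const 2))
  · intro y
    rw [abs_le]
    exact ⟨le_max_left _ _, max_le (by norm_num) (min_le_left _ _)⟩
  · intro y
    simp only [hg, neg_neg]
    have e : ((p (-y)).toReal - (p y).toReal) / 2 = -(((p y).toReal - (p (-y)).toReal) / 2) := by
      ring
    rw [e]
    generalize ((p y).toReal - (p (-y)).toReal) / 2 = a
    grind
  · rw [← hd]
    apply withDensity_congr_ae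
    filter_upwards [hsum] with y hy
    have h1 : p y ≠ ⊤ := by
      intro h; simp [h] at hy
    have h2 : p (-y) ≠ ⊤ := by
      intro h; simp [h] at hy
    have h3 : (p y).toReal + (p (-y)).toReal = 2 := by
      rw [← ENNReal.toReal_add h1 h2, hy]; simp
    have h4 : (0:ℝ) ≤ (p y).toReal := ENNReal.toReal_nonneg
    have h5 : (0:ℝ) ≤ (p (-y)).toReal := ENNReal.toReal_nonneg
    have : 1 + g y = (p y).toReal := by
      simp only [hg]
      rw [min_eq_right (by linarith), max_eq_right (by linarith)]
      linarith
    rw [this, ENNReal.ofReal_toReal h1]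

instance : IsProbabilityMeasure signMeasure := by
  constructor
  unfold signMeasure
  simp only [Measure.smul_apply, Measure.add_apply, measure_univ, smul_eq_mul]
  rw [one_add_one_eq_two, ENNReal.inv_mul_cancel (by norm_num) (by norm_num)]

lemma integral_sign_prod (PZ : Measure ℝ) [IsProbabilityMeasure PZ] {F : ℝ × ℝ → ℝ}
    (hF : Integrable F (signMeasure.prod PZ)) :
    ∫ q, F q ∂(signMeasure.prod PZ) = (∫ z, F (-1, z) ∂PZ + ∫ z, F (1, z) ∂PZ) / 2 := by
  rw [integral_prod _ hF]
  unfold signMeasure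
  rw [integral_smul_measure, integral_add_measure (integrable_dirac (by simp))
    (integrable_dirac (by simp)), integral_dirac, integral_dirac]
  simp
  ring

section Cap
variable {PZ lam : Measure ℝ} {g : ℝ → ℝ}

lemma integral_PZ [IsProbabilityMeasure PZ] (h : Chan PZ lam g) {F : ℝ → ℝ} :
    ∫ z, F z ∂PZ = ∫ y, (1 + g y) * F y ∂lam := by
  conv_lhs => rw [h.dens]
  rw [integral_withDensity_eq_integral_toReal_smul]
  · congr 1
    ext y
    rw [ENNReal.toReal_ofReal (by linarith [(abs_le.1 (h.bdd y)).1]), smul_eq_mul]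
  · exact ENNReal.measurable_ofReal.comp (measurable_const.add h.meas)
  · simp

lemma integral_neg_lam (h : Chan PZ lam g) {F : ℝ → ℝ} (hF : Measurable F) :
    ∫ y, F (-y) ∂lam = ∫ y, F y ∂lam := by
  have e := integral_map (μ := lam) h.symm.measurable.aemeasurable (f := F)
    hF.aestronglyMeasurable
  rw [h.symm.map_eq] at e
  exact e.symm

lemma integral_PZ_pm [IsProbabilityMeasure PZ] (h : Chan PZ lam g) {F : ℝ → ℝ} (hF : BM F) :
    ∫ z, F z ∂PZ = ∫ y, F y ∂lam + ∫ y, g y * F y ∂lam ∧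
    ∫ z, F (-z) ∂PZ = ∫ y, F y ∂lam - ∫ y, g y * F y ∂lam := by
  have := h.prob
  have hneg : Measurable (fun y : ℝ => -y) := measurable_neg
  have bg := h.bm.mul hF
  constructor
  · rw [integral_PZ h, ← integral_add (hF.integrable _) (bg.integrable _)]
    congr 1; ext y; ring
  · rw [integral_PZ h, ← integral_sub (hF.integrable _) (bg.integrable _),
      ← integral_neg_lam h (hF.sub bg).1]
    congr 1; ext y; rw [h.odd]; ring

lemma integral_prod_Y [IsProbabilityMeasure PZ] (h : Chan PZ lam g) {F : ℝ → ℝ} (hF : BM F) :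
    ∫ q, F (q.1 * q.2) ∂(signMeasure.prod PZ) = ∫ y, F y ∂lam := by
  have b : BM (fun q : ℝ × ℝ => F (q.1 * q.2)) := hF.comp (by fun_prop)
  rw [integral_sign_prod PZ (b.integrable _)]
  simp only [neg_mul, one_mul]
  rw [(integral_PZ_pm h hF).1, (integral_PZ_pm h hF).2]
  ring

lemma integral_prod_XY [IsProbabilityMeasure PZ] (h : Chan PZ lam g) {F : ℝ → ℝ} (hF : BM F) :
    Integrable (fun q : ℝ × ℝ => q.1) (signMeasure.prod PZ) ∧
    ∫ q, F (q.1 * q.2) * q.1 ∂(signMeasure.prod PZ) = ∫ y, g y * F y ∂lam := by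
  have i0 : Integrable (fun x : ℝ => x) signMeasure := by
    unfold signMeasure
    apply Integrable.smul_measure
    · exact (integrable_dirac (by simp)).add_measure (integrable_dirac (by simp))
    · simp
  have i1 : Integrable (fun q : ℝ × ℝ => q.1) (signMeasure.prod PZ) := i0.comp_fst PZ
  have b : BM (fun q : ℝ × ℝ => F (q.1 * q.2)) := hF.comp (by fun_prop)
  obtain ⟨K, hK⟩ := b.2
  refine ⟨i1, ?_⟩
  rw [integral_sign_prod PZ (i1.bdd_mul b.1.aestronglyMeasurable (Filter.Eventually.of_forall hK))]
  simp only [neg_mul, one_mul, mul_neg, mul_one]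
  rw [integral_neg, (integral_PZ_pm h hF).1, (integral_PZ_pm h hF).2]
  ring

lemma condMean_sign [IsProbabilityMeasure PZ] (h : Chan PZ lam g) :
    (fun q : ℝ × ℝ => g (q.1 * q.2)) =ᵐ[signMeasure.prod PZ]
    condMean (signMeasure.prod PZ) (fun q : ℝ × ℝ => q.1) (fun q : ℝ × ℝ => q.1 * q.2) := by
  have hY : Measurable (fun q : ℝ × ℝ => q.1 * q.2) := by fun_prop
  have bg : BM (fun q : ℝ × ℝ => g (q.1 * q.2)) := h.bm.comp hY
  unfold condMean
  apply ae_eq_condExp_of_forall_setIntegral_eq hY.comap_le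
    (integral_prod_XY h (BM.const 1)).1
  · intro s _ _
    exact (bg.integrable _).integrableOn
  · rintro s ⟨t, ht, rfl⟩ _
    have bi : BM (t.indicator (fun _ => (1:ℝ))) :=
      ⟨measurable_const.indicator ht, 1, fun x => by
        by_cases hx : x ∈ t <;> simp [hx]⟩
    have e1 := integral_prod_Y h (h.bm.mul bi)
    have e2 := (integral_prod_XY h bi).2
    rw [← integral_indicator (hY ht), ← integral_indicator (hY ht)]
    trans ∫ y, g y * t.indicator (fun _ => (1:ℝ)) y ∂lam
    · rw [← e1]
      congr 1
      ext q
      by_cases hq : q.1 * q.2 ∈ t <;> simp [Set.indicator, hq]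
    · rw [← e2]
      congr 1
      ext q
      by_cases hq : q.1 * q.2 ∈ t <;> simp [Set.indicator, hq]
  · apply Measurable.aestronglyMeasurable
    exact h.meas.comp (comap_measurable _)

lemma hb_eq (u : ℝ) :
    hb ((1 + u) / 2) = 1 - (eta (1 + u) + eta (1 - u)) / (2 * Real.log 2) := by
  have hl : Real.log 2 ≠ 0 := (Real.log_pos (by norm_num)).ne'
  have key : ∀ x : ℝ, x / 2 * Real.logb 2 (x / 2) = eta x / (2 * Real.log 2) - x / 2 := by
    intro x
    unfold eta
    by_cases hx : x = 0
    · simp [hx]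
    · rw [Real.logb, Real.log_div hx (by norm_num)]
      field_simp
  unfold hb
  rw [show 1 - (1 + u) / 2 = (1 - u) / 2 by ring, key, key]
  ring

lemma capacity_eq [IsProbabilityMeasure PZ] (h : Chan PZ lam g) :
    capacity PZ * Real.log 2 = kap lam g := by
  have := h.prob
  have hl : Real.log 2 ≠ 0 := (Real.log_pos (by norm_num)).ne'
  unfold capacity
  have e : ∫ p, hb ((1 + condMean (signMeasure.prod PZ)
        (fun q : ℝ × ℝ => q.1) (fun q : ℝ × ℝ => q.1 * q.2) p) / 2) ∂(signMeasure.prod PZ)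
      = ∫ p, (1 - (eta (1 + g (p.1 * p.2)) + eta (1 - g (p.1 * p.2))) / (2 * Real.log 2))
        ∂(signMeasure.prod PZ) := by
    apply integral_congr_ae
    filter_upwards [condMean_sign h] with p hp
    rw [← hp, hb_eq]
  have b1 := BM_zeta h
  have b2 := BM_zeta' h
  have b3 : BM (fun t => (eta (1 + g t) + eta (1 - g t)) / (2 * Real.log 2)) := by
    simpa only [div_eq_mul_inv] using (b1.add b2).mul (BM.const _)
  rw [e, integral_prod_Y h
    (F := fun t => 1 - (eta (1 + g t) + eta (1 - g t)) / (2 * Real.log 2)) ((BM.const 1).sub b3),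
    integral_sub ((BM.const 1).integrable _) (b3.integrable _), integral_div,
    integral_add (b1.integrable _) (b2.integrable _), kap_neg h]
  simp only [integral_const, probReal_univ, smul_eq_mul, mul_one]
  rw [kap]
  field_simp
  ring

end Cap



/-! ### Restricting to subcodes -/

section Restrict
variable {ι ι' J : Type*} [Fintype ι] [DecidableEq ι] [Fintype ι'] [DecidableEq ι'] [Fintype J]

lemma mp_reindex (P : Measure ℝ) [IsProbabilityMeasure P] {φ : ι' → ι}
    (hφ : Function.Injective φ) :
    MeasurePreserving (fun z : ι → ℝ => fun j => z (φ j)) (Measure.pi fun _ => P)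
      (Measure.pi fun _ => P) := by
  have hm : Measurable (fun z : ι → ℝ => fun j => z (φ j)) := by fun_prop
  refine ⟨hm, ?_⟩
  symm
  apply Measure.pi_eq
  intro s hs
  rw [Measure.map_apply hm (MeasurableSet.univ_pi hs)]
  have e : (fun z : ι → ℝ => fun j => z (φ j)) ⁻¹' (Set.univ.pi s)
      = Set.univ.pi (fun i => {x | ∀ j, φ j = i → x ∈ s j}) := by
    ext z
    simp only [Set.mem_preimage, Set.mem_pi, Set.mem_univ, true_implies]
    constructor
    · rintro h i j rfl
      exact h j
    · intro h j
      exact h _ j rfl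
  rw [e, Measure.pi_pi]
  symm
  apply Fintype.prod_of_injective φ hφ
  · intro i hi
    have : {x : ℝ | ∀ j, φ j = i → x ∈ s j} = Set.univ := by
      ext x
      simp only [Set.mem_ofPred_eq, Set.mem_univ, iff_true]
      intro j hj
      exact absurd ⟨j, hj⟩ hi
    rw [this, measure_univ]
  · intro i
    congr 1
    ext x
    simp only [Set.mem_ofPred_eq]
    constructor
    · intro hx j hj
      rw [hφ hj]; exact hx
    · intro hx
      exact hx i rfl

variable {PZ lam : Measure ℝ} {g : ℝ → ℝ} {C : Finset (ι → ℝ)} {C' : Finset (ι' → ℝ)}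

lemma variance_step [IsProbabilityMeasure PZ] [Nonempty J] (h : Chan PZ lam g) (hC : SCode C)
    (hC' : SCode C') (o : ι) (o' : ι') (φ : J → ι' → ι) (hφ : ∀ a, Function.Injective (φ a))
    (hφo : ∀ a, φ a o' = o) (hφC : ∀ a, ∀ x ∈ C, (fun j => x (φ a j)) ∈ C')
    (hcount : ∀ i, 2 * Nat.card {a : J // i ∈ φ a '' {o'}ᶜ} ≤ Fintype.card J) :
    qq PZ C g o * (1 - qq PZ C g o) ≤ 2 * (qq PZ C g o - qq PZ C' g o') := by
  set f := ff C g o with hf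
  set s : J → (ι → ℝ) → ℝ := fun a z => ff C' g o' (fun j => z (φ a j)) with hs
  have bf : BM f := BM_ff h hC o
  have bs : ∀ a, BM (s a) := fun a => (BM_ff h hC' o').comp (mp_reindex PZ (hφ a)).measurable
  have hsd : ∀ a, DependsOn (s a) (φ a '' {o'}ᶜ) := by
    intro a y y' hy
    apply ff_dep
    intro j hj
    exact hy _ ⟨j, hj, rfl⟩
  have hse : ∀ a, ∀ x ∈ C, ∀ y, s a (x * y) = x o * s a y := by
    intro a x hx y
    have := ff_equiv h hC' (hφC a x hx) o' (fun j => y (φ a j))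
    rw [hφo] at this
    exact this
  have his : ∀ a, ∫ z, s a z ∂(Measure.pi fun _ => PZ) = qq PZ C' g o' := by
    intro a
    have e := integral_map (μ := Measure.pi fun _ => PZ)
      (mp_reindex PZ (hφ a)).measurable.aemeasurable (f := ff C' g o')
      (BM_ff h hC' o').1.aestronglyMeasurable
    rw [(mp_reindex PZ (hφ a)).map_eq] at e
    exact e.symm
  have his2 : ∀ a, ∫ z, s a z ^ 2 ∂(Measure.pi fun _ => PZ) = qq PZ C' g o' := by
    intro a
    have e := integral_map (μ := Measure.pi fun _ => PZ)
      (mp_reindex PZ (hφ a)).measurable.aemeasurable (f := fun z => ff C' g o' z ^ 2)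
      ((BM_ff h hC' o').pow 2).1.aestronglyMeasurable
    rw [(mp_reindex PZ (hφ a)).map_eq, integral_ff_sq h hC'] at e
    exact e.symm
  have hdist : ∀ a, ∫ z, (f z - s a z) ^ 2 ∂(Measure.pi fun _ => PZ)
      = qq PZ C g o - qq PZ C' g o' := by
    intro a
    have e1 := integral_ff_mul h hC o (bs a) (hse a) (by
      intro y y' hy
      apply hsd a
      rintro i ⟨j, hj, rfl⟩
      apply hy
      intro hh
      apply hj
      rw [← hφo a] at hh
      exact hφ a hh)
    have e2 : ∀ z, (f z - s a z) ^ 2 = f z ^ 2 - 2 * (f z * s a z) + s a z ^ 2 := by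
      intro z; ring
    simp_rw [e2]
    rw [integral_add (((bf.pow 2).sub ((BM.const 2).mul (bf.mul (bs a)))).integrable _)
      (((bs a).pow 2).integrable _), integral_sub ((bf.pow 2).integrable _)
      (((BM.const 2).mul (bf.mul (bs a))).integrable _), integral_const_mul, e1, his, his2,
      integral_ff_sq h hC]
    ring
  have hv := variance_family PZ (fun a => φ a '' {o'}ᶜ) (Fintype.card J / 2)
    (fun i => by have := hcount i; omega) Finset.univ f s bf bs
    (by intro y y' hy; congr 1; ext i; exact hy i (by simp)) hsd
  rw [integral_ff_sq h hC, Finset.sum_congr rfl (fun a _ => hdist a)] at hv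
  change _ * (qq PZ C g o - (qq PZ C g o) ^ 2) ≤ _ at hv
  simp only [Finset.sum_const, Finset.card_univ, nsmul_eq_mul] at hv
  have hJ : (0:ℝ) < Fintype.card J := by exact_mod_cast Fintype.card_pos
  have hd : ((Fintype.card J / 2 : ℕ) : ℝ) ≤ (Fintype.card J : ℝ) / 2 := Nat.cast_div_le
  have hq0 := qq_nonneg h hC o
  have hq1 := qq_le_one h hC o
  have hvar : 0 ≤ qq PZ C g o - qq PZ C g o ^ 2 := by nlinarith
  have h3 : (Fintype.card J : ℝ) / 2 * (qq PZ C g o - qq PZ C g o ^ 2)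
      ≤ Fintype.card J * (qq PZ C g o - qq PZ C' g o') :=
    (mul_le_mul_of_nonneg_right (by linarith) hvar).trans hv
  have h4 : (Fintype.card J : ℝ) * (qq PZ C g o * (1 - qq PZ C g o))
      ≤ Fintype.card J * (2 * (qq PZ C g o - qq PZ C' g o')) := by nlinarith
  exact le_of_mul_le_mul_left h4 hJ

/-- Entropy bound for transitive codes. -/
lemma entropy_qq [IsProbabilityMeasure PZ] (h : Chan PZ lam g) (hC : SCode C)
    (hκ : 0 < kap lam g) (o : ι) (τ : ι → Equiv.Perm ι) (hτ : ∀ i, ∀ x ∈ C, x ∘ τ i ∈ C)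
    (hτ2 : ∀ i j, τ i (τ i j) = j) (hτo : ∀ i, τ i i = o) :
    (Fintype.card ι : ℝ) * kap lam g - Real.log C.card
      ≤ kap lam g * (Fintype.card ι * Real.sqrt (qq PZ C g o)) := by
  refine (entropy_main h hC hκ.le).trans ?_
  gcongr
  rw [← nsmul_eq_mul, ← Finset.card_univ, ← Finset.sum_const]
  gcongr with i
  rw [integral_abs_B_perm h (τ i) (hτ i) (hτ2 i) i o (hτo i)]
  exact integral_abs_B_le h hC o

end Restrict



/-! ### Reed–Muller codes -/

/-- Functions of degree at most `r` in the coordinate functions `x`. -/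
def degSp {X : Type*} {m : ℕ} (r : ℕ) (x : Fin m → X → ZMod 2) : Submodule (ZMod 2) (X → ZMod 2) :=
  Submodule.span (ZMod 2) {f | ∃ S : Finset (Fin m), S.card ≤ r ∧ f = ∏ j ∈ S, x j}

section DegSp
variable {X Y : Type*} {m n : ℕ}

lemma degSp_mono {r s : ℕ} (hrs : r ≤ s) (x : Fin m → X → ZMod 2) : degSp r x ≤ degSp s x := by
  apply Submodule.span_mono
  rintro f ⟨S, hS, rfl⟩
  exact ⟨S, hS.trans hrs, rfl⟩

lemma monomial_mem {r : ℕ} (x : Fin m → X → ZMod 2) {S : Finset (Fin m)} (hS : S.card ≤ r) :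
    ∏ j ∈ S, x j ∈ degSp r x := Submodule.subset_span ⟨S, hS, rfl⟩

lemma one_mem_degSp (r : ℕ) (x : Fin m → X → ZMod 2) : (1 : X → ZMod 2) ∈ degSp r x := by
  simpa using monomial_mem (r := r) x (S := ∅) (by simp)

lemma const_mem_degSp (r : ℕ) (x : Fin m → X → ZMod 2) (c : ZMod 2) :
    (fun _ => c : X → ZMod 2) ∈ degSp r x := by
  convert (degSp r x).smul_mem c (one_mem_degSp r x) using 1
  ext; simp

lemma coord_mem_degSp (x : Fin m → X → ZMod 2) (j : Fin m) : x j ∈ degSp 1 x := by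
  simpa using monomial_mem (r := 1) x (S := {j}) (by simp)

lemma mul_mem_degSp {r : ℕ} {x : Fin m → X → ZMod 2} {f h : X → ZMod 2} (hf : f ∈ degSp r x)
    (hh : h ∈ degSp 1 x) : f * h ∈ degSp (r + 1) x := by
  classical
  have key : ∀ (S : Finset (Fin m)), S.card ≤ r → ∀ h ∈ degSp 1 x,
      (∏ j ∈ S, x j) * h ∈ degSp (r + 1) x := by
    intro S hS h hh
    induction hh using Submodule.span_induction with
    | mem f hf =>
      obtain ⟨T, hT, rfl⟩ := hf
      rcases Nat.le_one_iff_eq_zero_or_eq_one.1 hT with h0 | h1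
      · rw [Finset.card_eq_zero.1 h0]
        simpa using monomial_mem x (S := S) (by omega)
      · obtain ⟨k, rfl⟩ := Finset.card_eq_one.1 h1
        rw [Finset.prod_singleton]
        by_cases hk : k ∈ S
        · have : (∏ j ∈ S, x j) * x k = ∏ j ∈ S, x j := by
            rw [← Finset.mul_prod_erase _ _ hk]
            have : x k * x k = x k := by
              ext y
              simp only [Pi.mul_apply]
              generalize x k y = a
              revert a; decide
            rw [mul_right_comm, this]
          rw [this]
          exact monomial_mem x (by omega)
        · rw [mul_comm, ← Finset.prod_insert hk]
          exact monomial_mem x (by rw [Finset.card_insert_of_notMem hk]; omega)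
    | zero => rw [mul_zero]; exact Submodule.zero_mem _
    | add a b _ _ ha hb => rw [mul_add]; exact Submodule.add_mem _ ha hb
    | smul c a _ ha => rw [mul_smul_comm]; exact Submodule.smul_mem _ _ ha
  induction hf using Submodule.span_induction with
  | mem f hf =>
    obtain ⟨S, hS, rfl⟩ := hf
    exact key S hS h hh
  | zero => rw [zero_mul]; exact Submodule.zero_mem _
  | add a b _ _ ha hb => rw [add_mul]; exact Submodule.add_mem _ ha hb
  | smul c a _ ha => rw [smul_mul_assoc]; exact Submodule.smul_mem _ _ ha

lemma degSp_pullback {r : ℕ} {x : Fin m → X → ZMod 2} {y : Fin n → Y → ZMod 2} (ψ : Y → X)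
    (hψ : ∀ k, (fun t => x k (ψ t)) ∈ degSp 1 y) {f : X → ZMod 2} (hf : f ∈ degSp r x) :
    (fun t => f (ψ t)) ∈ degSp r y := by
  classical
  induction hf using Submodule.span_induction with
  | mem f hf =>
    obtain ⟨S, hS, rfl⟩ := hf
    apply degSp_mono hS
    have e : (fun t => (∏ j ∈ S, x j) (ψ t)) = ∏ j ∈ S, fun t => x j (ψ t) := by
      ext t; simp [Finset.prod_apply]
    rw [e]
    clear e hS
    induction S using Finset.induction_on with
    | empty => simpa using one_mem_degSp 0 y
    | insert k S hk ih =>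
      rw [Finset.prod_insert hk, Finset.card_insert_of_notMem hk, mul_comm]
      exact mul_mem_degSp ih (hψ k)
  | zero => exact Submodule.zero_mem _
  | add a b _ _ ha hb => exact Submodule.add_mem _ ha hb
  | smul c a _ ha => exact Submodule.smul_mem _ _ ha

end DegSp

/-- Binary expansion. -/
def ev (m : ℕ) : Fin (2 ^ m) ≃ (Fin m → ZMod 2) := (finFunctionFinEquiv (m := 2) (n := m)).symm

lemma ev_apply (m : ℕ) (i : Fin (2 ^ m)) (j : Fin m) :
    ev m i j = ((((i : ℕ) / 2 ^ (j : ℕ)) % 2 : ℕ) : ZMod 2) := by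
  have h : (ev m i j).val = (i : ℕ) / 2 ^ (j : ℕ) % 2 := rfl
  rw [← h]
  exact (ZMod.natCast_zmod_val (n := 2) (ev m i j)).symm

/-- The coordinate functions. -/
def cf (m : ℕ) : Fin m → Fin (2 ^ m) → ZMod 2 := fun j i => ev m i j

lemma mem_RMcode {r m : ℕ} {c : Fin (2 ^ m) → ZMod 2} : c ∈ RMcode r m ↔ c ∈ degSp r (cf m) := by
  classical
  have hw : ∀ α, RMword r m α = ∑ S ∈ Finset.univ.filter (fun S : Finset (Fin m) => S.card ≤ r),
      α S • ∏ j ∈ S, cf m j := by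
    intro α
    ext i
    simp [RMword, Finset.sum_apply, Finset.prod_apply, cf, ev_apply]
  unfold RMcode
  simp only [Finset.mem_image, Finset.mem_univ, true_and]
  constructor
  · rintro ⟨α, rfl⟩
    rw [hw]
    refine Submodule.sum_mem _ fun S hS => Submodule.smul_mem _ _ (monomial_mem _ ?_)
    simpa using hS
  · intro hc
    induction hc using Submodule.span_induction with
    | mem f hf =>
      obtain ⟨S, hS, rfl⟩ := hf
      refine ⟨Pi.single S 1, ?_⟩
      rw [hw, Finset.sum_eq_single S]
      · simp
      · intro T _ hT
        simp [Pi.single_eq_of_ne hT]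
      · intro h; simp [hS] at h
    | zero => exact ⟨0, by simp [hw]⟩
    | add a b _ _ ha hb =>
      obtain ⟨α, rfl⟩ := ha
      obtain ⟨β, rfl⟩ := hb
      exact ⟨α + β, by simp [hw, add_smul, Finset.sum_add_distrib]⟩
    | smul c a _ ha =>
      obtain ⟨α, rfl⟩ := ha
      exact ⟨c • α, by simp [hw, Finset.smul_sum, smul_smul]⟩

lemma mem_bpskRM {r m : ℕ} {x : Fin (2 ^ m) → ℝ} :
    x ∈ bpskRM r m ↔ ∃ c ∈ degSp r (cf m), bpsk c = x := by
  unfold bpskRM bpskImage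
  simp only [Finset.mem_image, mem_RMcode]

lemma neg_one_pow_val_add (a b : ZMod 2) :
    (-1 : ℝ) ^ ((a + b).val) = (-1 : ℝ) ^ a.val * (-1 : ℝ) ^ b.val := by
  rw [← pow_add, ZMod.val_add, neg_one_pow_eq_pow_mod_two (n := a.val + b.val)]

lemma scode_RM (r m : ℕ) : SCode (bpskRM r m) := by
  refine ⟨?_, ?_, ?_⟩
  · intro x hx i
    obtain ⟨c, _, rfl⟩ := mem_bpskRM.1 hx
    exact neg_one_pow_eq_or ℝ _
  · intro x hx y hy
    obtain ⟨c, hc, rfl⟩ := mem_bpskRM.1 hx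
    obtain ⟨d, hd, rfl⟩ := mem_bpskRM.1 hy
    refine mem_bpskRM.2 ⟨c + d, Submodule.add_mem _ hc hd, ?_⟩
    ext i
    exact neg_one_pow_val_add _ _
  · exact ⟨_, mem_bpskRM.2 ⟨0, Submodule.zero_mem _, rfl⟩⟩

lemma bpskRM_pullback {r m n : ℕ} (ψ : Fin (2 ^ n) → Fin (2 ^ m))
    (hψ : ∀ k, (fun t => cf m k (ψ t)) ∈ degSp 1 (cf n)) {x : Fin (2 ^ m) → ℝ}
    (hx : x ∈ bpskRM r m) : (fun t => x (ψ t)) ∈ bpskRM r n := by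
  obtain ⟨c, hc, rfl⟩ := mem_bpskRM.1 hx
  exact mem_bpskRM.2 ⟨_, degSp_pullback ψ hψ hc, rfl⟩

/-- The origin. -/
def oo (m : ℕ) : Fin (2 ^ m) := (ev m).symm 0

/-- Translation by the point with index `i`. -/
def tau (m : ℕ) (i : Fin (2 ^ m)) : Equiv.Perm (Fin (2 ^ m)) :=
  ((ev m).trans (Equiv.addRight (ev m i))).trans (ev m).symm

lemma ev_tau (m : ℕ) (i j : Fin (2 ^ m)) : ev m (tau m i j) = ev m j + ev m i := by
  simp [tau]

lemma char_two_add {m : ℕ} (a : Fin m → ZMod 2) : a + a = 0 := by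
  ext j
  simp only [Pi.add_apply, Pi.zero_apply]
  generalize a j = b
  revert b; decide

lemma tau_tau (m : ℕ) (i j : Fin (2 ^ m)) : tau m i (tau m i j) = j := by
  apply (ev m).injective
  rw [ev_tau, ev_tau, add_assoc, char_two_add, add_zero]

lemma tau_self (m : ℕ) (i : Fin (2 ^ m)) : tau m i i = oo m := by
  apply (ev m).injective
  rw [ev_tau, char_two_add, oo, Equiv.apply_symm_apply]

lemma tau_mem {r m : ℕ} (i : Fin (2 ^ m)) {x : Fin (2 ^ m) → ℝ} (hx : x ∈ bpskRM r m) :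
    x ∘ tau m i ∈ bpskRM r m := by
  apply bpskRM_pullback (tau m i) _ hx
  intro k
  have : (fun t => cf m k (tau m i t)) = cf m k + fun _ => ev m i k := by
    ext t
    simp [cf, ev_tau]
  rw [this]
  exact Submodule.add_mem _ (coord_mem_degSp _ _) (const_mem_degSp _ _ _)

/-- Linear embedding of a hyperplane as a graph. -/
def phi (m : ℕ) (a : Fin m → ZMod 2) (w : Fin (2 ^ m)) : Fin (2 ^ (m + 1)) :=
  (ev (m + 1)).symm (Fin.cons (∑ j, a j * ev m w j) (ev m w))

lemma ev_phi (m : ℕ) (a : Fin m → ZMod 2) (w : Fin (2 ^ m)) :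
    ev (m + 1) (phi m a w) = Fin.cons (∑ j, a j * ev m w j) (ev m w) := by
  simp [phi]

lemma phi_injective (m : ℕ) (a : Fin m → ZMod 2) : Function.Injective (phi m a) := by
  intro w w' h
  have := congrArg (ev (m + 1)) h
  rw [ev_phi, ev_phi] at this
  exact (ev m).injective (Fin.cons_inj.1 this).2

lemma phi_oo (m : ℕ) (a : Fin m → ZMod 2) : phi m a (oo m) = oo (m + 1) := by
  apply (ev (m + 1)).injective
  rw [ev_phi, oo, oo, Equiv.apply_symm_apply, Equiv.apply_symm_apply]
  ext k
  refine Fin.cases ?_ (fun k => ?_) k <;> simp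

lemma phi_mem {r m : ℕ} (a : Fin m → ZMod 2) {x : Fin (2 ^ (m + 1)) → ℝ}
    (hx : x ∈ bpskRM r (m + 1)) : (fun t => x (phi m a t)) ∈ bpskRM r m := by
  apply bpskRM_pullback (phi m a) _ hx
  intro k
  refine Fin.cases ?_ (fun k => ?_) k
  · have : (fun t => cf (m + 1) 0 (phi m a t)) = ∑ j, a j • cf m j := by
      ext t
      simp [cf, ev_phi, Finset.sum_apply]
    rw [this]
    exact Submodule.sum_mem _ fun j _ => Submodule.smul_mem _ _ (coord_mem_degSp _ _)
  · have : (fun t => cf (m + 1) k.succ (phi m a t)) = cf m k := by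
      ext t
      simp [cf, ev_phi]
    rw [this]
    exact coord_mem_degSp _ _

lemma phi_count (m : ℕ) (i : Fin (2 ^ (m + 1))) :
    2 * Nat.card {a : Fin m → ZMod 2 // i ∈ phi m a '' {oo m}ᶜ}
      ≤ Fintype.card (Fin m → ZMod 2) := by
  classical
  set T : Finset (Fin m → ZMod 2) := Finset.univ.filter (fun a => i ∈ phi m a '' {oo m}ᶜ) with hT
  have hcard : Nat.card {a : Fin m → ZMod 2 // i ∈ phi m a '' {oo m}ᶜ} = T.card := by
    rw [Nat.card_eq_fintype_card, Fintype.card_subtype]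
  rw [hcard]
  have hmem : ∀ a ∈ T, ∑ j, a j * (Fin.tail (ev (m + 1) i) j) = ev (m + 1) i 0
      ∧ Fin.tail (ev (m + 1) i) ≠ 0 := by
    intro a ha
    simp only [hT, Finset.mem_filter, Finset.mem_univ, true_and] at ha
    obtain ⟨w, hw, rfl⟩ := ha
    rw [ev_phi, Fin.tail_cons, Fin.cons_zero]
    refine ⟨rfl, fun h0 => hw ?_⟩
    rw [Set.mem_singleton_iff, oo, ← h0, Equiv.symm_apply_apply]
  by_cases hw : Fin.tail (ev (m + 1) i) = 0
  · have : T = ∅ := by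
      apply Finset.eq_empty_of_forall_notMem
      intro a ha
      exact (hmem a ha).2 hw
    simp [this]
  obtain ⟨k, hk⟩ := Function.ne_iff.1 hw
  have hdisj : Disjoint T (T.image (fun a => a + Pi.single k 1)) := by
    rw [Finset.disjoint_left]
    intro a ha ha'
    obtain ⟨b, hb, rfl⟩ := Finset.mem_image.1 ha'
    have h1 := (hmem _ ha).1
    have h2 := (hmem _ hb).1
    simp only [Pi.add_apply, add_mul, Finset.sum_add_distrib] at h1
    rw [h2] at h1
    simp [Pi.single_apply] at h1
    exact hk h1
  have hc : (T.image (fun a => a + Pi.single k 1)).card = T.card :=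
    Finset.card_image_of_injective _ (add_left_injective _)
  have := Finset.card_le_univ (T ∪ T.image (fun a => a + Pi.single k 1))
  rw [Finset.card_union_of_disjoint hdisj, hc] at this
  omega

lemma card_RM (r m : ℕ) : (bpskRM r m).card ≤ 2 ^ (∑ i ∈ Finset.range (r + 1), m.choose i) := by
  classical
  have h1 : (bpskRM r m).card ≤ (RMcode r m).card := by
    unfold bpskRM bpskImage
    exact @Finset.card_image_le _ _ _ _ (Classical.decEq _)
  refine h1.trans ?_
  set U : Finset (Finset (Fin m)) := Finset.univ.filter (fun S => S.card ≤ r) with hU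
  have h2 : RMcode r m ⊆ Finset.image
      (fun β : U → ZMod 2 => RMword r m (fun S => if h : S ∈ U then β ⟨S, h⟩ else 0))
      Finset.univ := by
    intro c hc
    unfold RMcode at hc
    obtain ⟨α, _, rfl⟩ := Finset.mem_image.1 hc
    refine Finset.mem_image.2 ⟨fun S => α S, Finset.mem_univ _, ?_⟩
    ext i
    unfold RMword
    apply Finset.sum_congr rfl
    intro S hS
    have hS2 : S ∈ U := hS
    simp only [dif_pos hS2]
  have h3 : U.card = ∑ i ∈ Finset.range (r + 1), m.choose i := by
    rw [Finset.card_eq_sum_card_fiberwise (f := Finset.card) (t := Finset.range (r + 1))]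
    · apply Finset.sum_congr rfl
      intro k hk
      have : U.filter (fun S => S.card = k) = Finset.powersetCard k Finset.univ := by
        ext S
        simp only [hU, Finset.mem_filter, Finset.mem_univ, true_and, Finset.mem_powersetCard,
          Finset.subset_univ]
        have := Finset.mem_range.1 hk
        constructor
        · exact fun h => h.2
        · intro h; exact ⟨by omega, h⟩
      rw [this, Finset.card_powersetCard]
      simp
    · intro S hS
      have : S.card ≤ r := by simpa [hU] using hS
      simpa using Nat.lt_succ_of_le this
  refine (Finset.card_le_card h2).trans (Finset.card_image_le.trans ?_)
  rw [Finset.card_univ, Fintype.card_fun, Fintype.card_coe, h3, ZMod.card]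

section QRM
variable {PZ lam : Measure ℝ} {g : ℝ → ℝ}

/-- The overlap of RM(r,m). -/
noncomputable def qRM (PZ : Measure ℝ) (g : ℝ → ℝ) (r m : ℕ) : ℝ := qq PZ (bpskRM r m) g (oo m)

lemma qRM_step [IsProbabilityMeasure PZ] (h : Chan PZ lam g) (r m : ℕ) :
    qRM PZ g r (m + 1) * (1 - qRM PZ g r (m + 1)) ≤ 2 * (qRM PZ g r (m + 1) - qRM PZ g r m) :=
  variance_step h (scode_RM r (m + 1)) (scode_RM r m) (oo (m + 1)) (oo m) (phi m)
    (phi_injective m) (phi_oo m) (fun a _ hx => phi_mem a hx) (phi_count m)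

lemma qRM_entropy [IsProbabilityMeasure PZ] (h : Chan PZ lam g) (hC : 0 < capacity PZ) (r m : ℕ) :
    1 - RMrate r m / capacity PZ ≤ Real.sqrt (qRM PZ g r m) := by
  have hl : 0 < Real.log 2 := Real.log_pos (by norm_num)
  have hcap := capacity_eq h
  have hκ : 0 < kap lam g := by rw [← hcap]; positivity
  have he := entropy_qq h (scode_RM r m) hκ (oo m) (tau m) (fun i x hx => tau_mem i hx)
    (tau_tau m) (tau_self m)
  have hcard : Real.log (bpskRM r m).card ≤ 2 ^ m * RMrate r m * Real.log 2 := by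
    have h0 : (0:ℝ) < (bpskRM r m).card := by exact_mod_cast (scode_RM r m).ne.card_pos
    have h1 : ((bpskRM r m).card : ℝ) ≤ 2 ^ (∑ i ∈ Finset.range (r + 1), m.choose i) := by
      exact_mod_cast card_RM r m
    have h2 := Real.log_le_log h0 h1
    rw [Real.log_pow] at h2
    refine h2.trans (le_of_eq ?_)
    unfold RMrate
    rw [← mul_assoc, mul_inv_cancel₀ (by positivity), one_mul]
    push_cast
    rfl
  rw [Fintype.card_fin, ← hcap] at he
  change _ ≤ _ * (_ * Real.sqrt (qRM PZ g r m)) at he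
  push_cast at he
  have hN : (0:ℝ) < 2 ^ m := by positivity
  have hpos : 0 < (2:ℝ) ^ m * (capacity PZ * Real.log 2) := by positivity
  have h5 : (2:ℝ) ^ m * (capacity PZ * Real.log 2) * (1 - RMrate r m / capacity PZ)
      = 2 ^ m * (capacity PZ * Real.log 2) - 2 ^ m * RMrate r m * Real.log 2 := by
    field_simp
  have h6 : (2:ℝ) ^ m * (capacity PZ * Real.log 2) * (1 - RMrate r m / capacity PZ)
      ≤ 2 ^ m * (capacity PZ * Real.log 2) * Real.sqrt (qRM PZ g r m) := by
    rw [h5]; nlinarith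
  exact le_of_mul_le_mul_left h6 hpos

end QRM



/-! ### Rates -/

lemma centralBinom_sq (n : ℕ) : n.centralBinom ^ 2 * (2 * n + 1) ≤ 16 ^ n := by
  induction n with
  | zero => simp
  | succ n ih =>
    have h := Nat.succ_mul_centralBinom_succ n
    have hpos : 0 < (n + 1) ^ 2 := by positivity
    apply Nat.le_of_mul_le_mul_left _ hpos
    calc (n + 1) ^ 2 * ((n + 1).centralBinom ^ 2 * (2 * (n + 1) + 1))
        = ((n + 1) * (n + 1).centralBinom) ^ 2 * (2 * n + 3) := by ring
      _ = (n.centralBinom ^ 2 * (2 * n + 1)) * (4 * (2 * n + 1) * (2 * n + 3)) := by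
          rw [h]; ring
      _ ≤ 16 ^ n * (4 * (2 * n + 1) * (2 * n + 3)) := Nat.mul_le_mul_right _ ih
      _ ≤ 16 ^ n * (16 * (n + 1) ^ 2) := Nat.mul_le_mul_left _ (by nlinarith)
      _ = (n + 1) ^ 2 * 16 ^ (n + 1) := by ring

lemma choose_sq_mul (m r : ℕ) : (m.choose r) ^ 2 * m ≤ 4 ^ m := by
  rcases Nat.even_or_odd m with ⟨n, rfl⟩ | ⟨n, rfl⟩
  · have h1 : (n + n).choose r ≤ n.centralBinom := by
      rw [← two_mul]; exact Nat.choose_le_centralBinom r n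
    have h2 := centralBinom_sq n
    calc ((n + n).choose r) ^ 2 * (n + n) ≤ n.centralBinom ^ 2 * (2 * n + 1) :=
          Nat.mul_le_mul (Nat.pow_le_pow_left h1 2) (by omega)
      _ ≤ 16 ^ n := h2
      _ = 4 ^ (n + n) := by rw [← two_mul, pow_mul]; norm_num
  · have h1 : (2 * n + 1).choose r ≤ 2 * n.centralBinom := by
      cases r with
      | zero =>
        have := Nat.centralBinom_pos n
        rw [Nat.choose_zero_right]
        omega
      | succ r =>
        rw [Nat.choose_succ_succ]
        have := Nat.choose_le_centralBinom r n
        have := Nat.choose_le_centralBinom (r + 1) n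
        simp only [Nat.succ_eq_add_one]
        omega
    have h2 := centralBinom_sq n
    calc ((2 * n + 1).choose r) ^ 2 * (2 * n + 1) ≤ (2 * n.centralBinom) ^ 2 * (2 * n + 1) := by
          gcongr
      _ = 4 * (n.centralBinom ^ 2 * (2 * n + 1)) := by ring
      _ ≤ 4 * 16 ^ n := by gcongr
      _ = 4 ^ (2 * n + 1) := by rw [pow_succ, pow_mul]; ring

lemma RMrate_succ (r m : ℕ) :
    RMrate r m = RMrate r (m + 1) + (m.choose r : ℝ) / 2 ^ m / 2 := by
  have h : ∑ i ∈ Finset.range (r + 1), ((m + 1).choose i : ℝ)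
      = 2 * ∑ i ∈ Finset.range (r + 1), (m.choose i : ℝ) - m.choose r := by
    induction r with
    | zero => simp; norm_num
    | succ r ih =>
      rw [Finset.sum_range_succ, ih, Finset.sum_range_succ _ (r + 1), Nat.choose_succ_succ]
      push_cast
      simp only [Nat.succ_eq_add_one]
      ring
  unfold RMrate
  rw [h, pow_succ]
  field_simp
  ring

lemma RMrate_close {ε : ℝ} (hε : 0 < ε) :
    ∃ M : ℕ, ∀ m ≥ M, ∀ r, RMrate r m ≤ RMrate r (m + 1) + ε := by
  obtain ⟨M, hM⟩ := exists_nat_gt (1 / ε ^ 2)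
  refine ⟨M, fun m hm r => ?_⟩
  rw [RMrate_succ r m]
  have h1 : ((m.choose r : ℝ)) ^ 2 * m ≤ 4 ^ m := by exact_mod_cast choose_sq_mul m r
  set c : ℝ := (m.choose r : ℝ) / 2 ^ m with hc
  have hc0 : 0 ≤ c := by positivity
  have h2 : c ^ 2 * m ≤ 1 := by
    rw [hc, div_pow, ← pow_mul, mul_comm m 2, pow_mul, div_mul_eq_mul_div,
      div_le_one (by positivity)]
    norm_num
    exact h1
  have h3 : 1 < ε ^ 2 * m := by
    have : (M : ℝ) ≤ m := by exact_mod_cast hm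
    rw [div_lt_iff₀ (by positivity)] at hM
    nlinarith [sq_nonneg ε]
  have h4 : c ≤ ε := by
    by_contra hlt
    push Not at hlt
    have : ε ^ 2 ≤ c ^ 2 := by gcongr
    have hm0 : (0:ℝ) ≤ m := Nat.cast_nonneg m
    nlinarith
  linarith

/-! ### The limit of the overlaps -/

section Lim
variable {PZ lam : Measure ℝ} {g : ℝ → ℝ}

lemma qRM_bds [IsProbabilityMeasure PZ] (h : Chan PZ lam g) (r m : ℕ) :
    0 ≤ qRM PZ g r m ∧ qRM PZ g r m ≤ 1 :=
  ⟨qq_nonneg h (scode_RM r m) _, qq_le_one h (scode_RM r m) _⟩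

lemma qRM_mono [IsProbabilityMeasure PZ] (h : Chan PZ lam g) (r : ℕ) : Monotone (qRM PZ g r) := by
  apply monotone_nat_of_le_succ
  intro m
  have h1 := qRM_step h r m
  have h2 := qRM_bds h r (m + 1)
  nlinarith

lemma qRM_sum [IsProbabilityMeasure PZ] (h : Chan PZ lam g) (r M K : ℕ) {b : ℝ}
    (hb : ∀ j ≤ K, b ≤ qRM PZ g r (M + j)) :
    K * (b * (1 - qRM PZ g r (M + K))) ≤ 2 := by
  have key : ∀ j ≤ K, (j : ℝ) * (b * (1 - qRM PZ g r (M + K)))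
      ≤ 2 * (qRM PZ g r (M + j) - qRM PZ g r M) := by
    intro j
    induction j with
    | zero => simp
    | succ j ih =>
      intro hj
      have h1 := ih (by omega)
      have h2 := qRM_step h r (M + j)
      rw [add_assoc] at h2
      have h3 := hb (j + 1) hj
      have h4 : qRM PZ g r (M + (j + 1)) ≤ qRM PZ g r (M + K) := qRM_mono h r (by omega)
      have h5 := qRM_bds h r (M + K)
      have h6 := qRM_bds h r (M + (j + 1))
      have h7 : b * (1 - qRM PZ g r (M + K))
          ≤ qRM PZ g r (M + (j + 1)) * (1 - qRM PZ g r (M + (j + 1))) :=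
        (mul_le_mul_of_nonneg_right h3 (by linarith)).trans
          (mul_le_mul_of_nonneg_left (by linarith) h6.1)
      push_cast
      linarith
  have h1 := key K le_rfl
  have h2 := qRM_bds h r (M + K)
  have h3 := qRM_bds h r M
  linarith

lemma rate_back {ε : ℝ} {M : ℕ} (hM : ∀ m ≥ M, ∀ r, RMrate r m ≤ RMrate r (m + 1) + ε) (r m k : ℕ)
    (hm : M ≤ m) : RMrate r m ≤ RMrate r (m + k) + k * ε := by
  induction k with
  | zero => simp
  | succ k ih =>
    have := hM (m + k) (by omega) r
    rw [add_assoc] at this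
    push_cast
    linarith

lemma qRM_tendsto [IsProbabilityMeasure PZ] (h : Chan PZ lam g) (hC0 : 0 < capacity PZ)
    (r m : ℕ → ℕ) (hmono : StrictMono m) (R : ℝ) (hRC : R < capacity PZ)
    (hRlim : Filter.Tendsto (fun n => RMrate (r n) (m n)) Filter.atTop (nhds R)) :
    Filter.Tendsto (fun n => (1 - qRM PZ g (r n) (m n)) / 2) Filter.atTop (nhds 0) := by
  set C := capacity PZ with hC
  set c := (C - R) / (2 * C) with hc
  have hc0 : 0 < c := div_pos (by linarith) (by linarith)
  rw [Metric.tendsto_atTop']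
  intro ε hε
  obtain ⟨K, hK⟩ := exists_nat_gt (1 / (c ^ 2 * ε))
  have hKpos : (0:ℝ) < K := lt_trans (by positivity) hK
  have hδ : 0 < (C - R) / (4 * K) := div_pos (by linarith) (by linarith)
  obtain ⟨M, hM⟩ := RMrate_close hδ
  have hev : ∀ᶠ n in Filter.atTop, RMrate (r n) (m n) < R + (C - R) / 4 :=
    hRlim.eventually_lt_const (by linarith)
  obtain ⟨N, hN⟩ := Filter.eventually_atTop.1 hev
  refine ⟨max N (M + K), fun n hn => ?_⟩
  have hn1 : N ≤ n := (le_max_left _ _).trans hn.le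
  have hn2 : M + K ≤ m n := ((le_max_right _ _).trans hn.le).trans (hmono.id_le n)
  obtain ⟨M', hM'⟩ : ∃ M', m n = M' + K := ⟨m n - K, by omega⟩
  have hr := hN n hn1
  have hbd := qRM_bds h (r n) (m n)
  rw [hM'] at hr hbd ⊢
  have hb : ∀ j ≤ K, c ^ 2 ≤ qRM PZ g (r n) (M' + j) := by
    intro j hj
    have h1 := rate_back hM (r n) (M' + j) (K - j) (by omega)
    rw [show M' + j + (K - j) = M' + K by omega] at h1
    have h2 : ((K - j : ℕ) : ℝ) * ((C - R) / (4 * K)) ≤ (C - R) / 4 := by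
      have : ((K - j : ℕ) : ℝ) ≤ K := by exact_mod_cast Nat.sub_le _ _
      calc ((K - j : ℕ) : ℝ) * ((C - R) / (4 * K)) ≤ K * ((C - R) / (4 * K)) := by gcongr
        _ = (C - R) / 4 := by field_simp
    have h3 : RMrate (r n) (M' + j) ≤ (C + R) / 2 := by linarith
    have h4 := qRM_entropy h hC0 (r n) (M' + j)
    have h5 : c ≤ Real.sqrt (qRM PZ g (r n) (M' + j)) := by
      refine le_trans ?_ h4
      rw [← hC, hc]
      have : RMrate (r n) (M' + j) / C ≤ (C + R) / 2 / C := by gcongr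
      have e : (C - R) / (2 * C) = 1 - (C + R) / 2 / C := by field_simp; ring
      linarith
    have h6 := (qRM_bds h (r n) (M' + j)).1
    calc c ^ 2 ≤ Real.sqrt (qRM PZ g (r n) (M' + j)) ^ 2 := by gcongr
      _ = _ := Real.sq_sqrt h6
  have hs := qRM_sum h (r n) M' K hb
  rw [Real.dist_eq, sub_zero, abs_of_nonneg (by linarith)]
  rw [div_lt_iff₀ (by positivity)] at hK
  by_contra hcon
  push Not at hcon
  have : (K:ℝ) * (c ^ 2 * (2 * ε)) ≤ K * (c ^ 2 * (1 - qRM PZ g (r n) (M' + K))) := by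
    gcongr
    linarith
  nlinarith

end Lim

/-! ### Bit error rate -/

section Ber

lemma uniform_prob {α : Type*} [MeasurableSpace α] {s : Finset α} (hs : s.Nonempty) :
    IsProbabilityMeasure (uniformOnFinset s) := by
  constructor
  unfold uniformOnFinset
  simp only [Measure.smul_apply, Measure.coe_finsetSum, Finset.sum_apply, measure_univ,
    smul_eq_mul, Finset.sum_const, nsmul_eq_mul, mul_one]
  apply ENNReal.inv_mul_cancel
  · simpa using hs.ne_empty
  · simp

lemma integral_uniform {α : Type*} [MeasurableSpace α] [MeasurableSingletonClass α]
    (s : Finset α) (F : α → ℝ) :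
    Integrable F (uniformOnFinset s) ∨ s = ∅ := by
  rcases s.eq_empty_or_nonempty with h | h
  · exact Or.inr h
  left
  unfold uniformOnFinset
  apply Integrable.smul_measure
  · exact integrable_finsetSum_measure.2 fun x _ => integrable_dirac (by simp)
  · simpa using h.ne_empty

lemma integral_uniform_prod {α β : Type*} [MeasurableSpace α] [MeasurableSingletonClass α]
    [MeasurableSpace β] {s : Finset α} (hs : s.Nonempty) (P : Measure β) [IsProbabilityMeasure P]
    {F : α × β → ℝ} (hF : Integrable F ((uniformOnFinset s).prod P)) :
    ∫ p, F p ∂((uniformOnFinset s).prod P) = (s.card : ℝ)⁻¹ * ∑ x ∈ s, ∫ z, F (x, z) ∂P := by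
  have := uniform_prob hs
  rw [integral_prod _ hF]
  unfold uniformOnFinset
  rw [integral_smul_measure, integral_finsetSum_measure fun x _ => integrable_dirac (by simp)]
  simp

variable {PZ lam : Measure ℝ} {g : ℝ → ℝ}

lemma integral_mul_le_abs_condExp {Ω : Type*} {m m0 : MeasurableSpace Ω} {μ : Measure Ω}
    [IsProbabilityMeasure μ] (hm : m ≤ m0) {f s : Ω → ℝ} (hf : Integrable f μ)
    (hs : StronglyMeasurable[m] s) (hb : ∀ ω, |s ω| ≤ 1) :
    ∫ ω, f ω * s ω ∂μ ≤ ∫ ω, |(μ[f | m]) ω| ∂μ := by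
  have hs' : AEStronglyMeasurable s μ := (hs.mono hm).aestronglyMeasurable
  have ifs : Integrable (f * s) μ :=
    hf.mul_bdd (c := 1) hs' (Filter.Eventually.of_forall hb)
  have hpull := condExp_mul_of_stronglyMeasurable_right hs ifs hf
  have e1 := integral_condExp (μ := μ) (f := f * s) hm
  rw [integral_congr_ae hpull] at e1
  refine (le_of_eq e1.symm).trans ?_
  apply integral_mono
  · exact integrable_condExp.mul_bdd (c := 1) hs' (Filter.Eventually.of_forall hb)
  · exact integrable_condExp.abs
  · intro ω
    refine (le_abs_self _).trans ?_
    simp only [Pi.mul_apply]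
    rw [abs_mul]
    exact mul_le_of_le_one_right (abs_nonneg _) (hb ω)

lemma stronglyMeasurable_comap_comp {Ω β : Type*} [mβ : MeasurableSpace β] (f : Ω → β) {s : β → ℝ}
    (hs : Measurable s) : StronglyMeasurable[MeasurableSpace.comap f mβ] (fun ω => s (f ω)) := by
  have h1 : Measurable[MeasurableSpace.comap f mβ] f := comap_measurable f
  have h2 : Measurable[MeasurableSpace.comap f mβ] (fun ω => s (f ω)) := hs.comp h1
  exact h2.stronglyMeasurable

lemma BER_bounds_aux {ι : Type*} [Fintype ι] [DecidableEq ι] [IsProbabilityMeasure PZ]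
    (h : Chan PZ lam g) {Ω : Type*} [MeasurableSpace Ω]
    (μ : Measure Ω) [IsProbabilityMeasure μ] {C : Finset (ι → ℝ)} (hC : SCode C) (X Z : Ω → (ι → ℝ))
    (hX : Measurable X) (hZ : Measurable Z)
    (hlaw : Measure.map (fun ω => (X ω, Z ω)) μ
        = (uniformOnFinset C).prod (Measure.pi fun _ => PZ)) (i o : ι)
    (τ : Equiv.Perm ι) (hτ : ∀ x ∈ C, x ∘ τ ∈ C) (htau : τ o = i) :
    0 ≤ BER μ (fun ω => X ω i) (fun ω => fun j => X ω j * Z ω j) ∧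
    BER μ (fun ω => X ω i) (fun ω => fun j => X ω j * Z ω j) ≤ (1 - qq PZ C g o) / 2 := by
  have hne := hC.ne
  have hcard : (C.card : ℝ) ≠ 0 := by exact_mod_cast hne.card_pos.ne'
  have := uniform_prob hne
  have hXZ : Measurable (fun ω => (X ω, Z ω)) := hX.prodMk hZ
  set U := uniformOnFinset C with hU
  set Q : Measure (ι → ℝ) := Measure.pi fun _ => PZ with hQ
  have i1 : Integrable (fun x : ι → ℝ => x i) U :=
    (integral_uniform _ _).resolve_right hne.ne_empty
  have i2 : Integrable (fun p : (ι → ℝ) × (ι → ℝ) => p.1 i) (U.prod Q) :=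
    i1.comp_fst Q
  have iX : Integrable (fun ω => X ω i) μ := by
    rw [← hlaw] at i2
    exact i2.comp_measurable hXZ
  have hY : Measurable (fun ω => fun j => X ω j * Z ω j) := by
    fun_prop
  have hEabs : ∫ ω, |X ω i| ∂μ = 1 := by
    have e := integral_map (μ := μ) hXZ.aemeasurable
      (f := fun p : (ι → ℝ) × (ι → ℝ) => |p.1 i|)
      (by rw [hlaw]; exact i2.abs.aestronglyMeasurable)
    rw [hlaw, integral_uniform_prod hne Q i2.abs] at e
    rw [← e]
    have : ∀ x ∈ C, ∫ z, |x i| ∂Q = 1 := by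
      intro x hx
      rcases hC.pm x hx i with h' | h' <;> simp [h']
    rw [Finset.sum_congr rfl this]
    simp [hcard]
  set s : (ι → ℝ) → ℝ := fun y => ff C g o (fun j => y (τ j)) with hs
  have hmp := mp_reindex PZ τ.injective
  have bs : BM s := (BM_ff h hC o).comp hmp.measurable
  have hsabs : ∀ y, |s y| ≤ 1 := fun y => abs_ff_le h hC _ _
  have hsq : ∫ z, s z ∂Q = qq PZ C g o := by
    have e := integral_map (μ := Q) hmp.measurable.aemeasurable (f := ff C g o)
      (BM_ff h hC o).1.aestronglyMeasurable
    rw [hmp.map_eq] at e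
    exact e.symm
  have hse : ∀ x ∈ C, ∀ y, s (x * y) = x i * s y := by
    intro x hx y
    have := ff_equiv h hC (hτ x hx) o (fun j => y (τ j))
    rw [Function.comp_apply, htau] at this
    exact this
  have hsm : Measurable (fun p : (ι → ℝ) × (ι → ℝ) => s (p.1 * p.2)) :=
    bs.1.comp (by fun_prop)
  have hExs : ∫ ω, X ω i * s (fun j => X ω j * Z ω j) ∂μ = qq PZ C g o := by
    have i3 : Integrable (fun p : (ι → ℝ) × (ι → ℝ) =>
        p.1 i * s (p.1 * p.2)) (U.prod Q) :=
      i2.mul_bdd (c := 1) hsm.aestronglyMeasurable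
        (Filter.Eventually.of_forall fun p => hsabs _)
    have e := integral_map (μ := μ) hXZ.aemeasurable
      (f := fun p : (ι → ℝ) × (ι → ℝ) => p.1 i * s (p.1 * p.2))
      (by rw [hlaw]; exact i3.aestronglyMeasurable)
    rw [hlaw, integral_uniform_prod hne Q i3] at e
    refine e.symm.trans ?_
    have : ∀ x ∈ C, ∫ z, x i * s (x * z) ∂Q = qq PZ C g o := by
      intro x hx
      rw [← hsq]
      congr 1
      ext z
      rw [hse x hx, ← mul_assoc, hC.sq hx, one_mul]
    simp only
    rw [Finset.sum_congr rfl this, Finset.sum_const, nsmul_eq_mul, ← mul_assoc,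
      inv_mul_cancel₀ hcard, one_mul]
  clear_value s
  have hsY := stronglyMeasurable_comap_comp (fun ω => fun j => X ω j * Z ω j) bs.1
  have hup := integral_abs_condExp_le (μ := μ) (m := MeasurableSpace.comap
    (fun ω => fun j => X ω j * Z ω j) inferInstance) (fun ω => X ω i)
  have hlow := integral_mul_le_abs_condExp hY.comap_le iX hsY (fun ω => hsabs _)
  rw [hEabs] at hup
  rw [hExs] at hlow
  unfold BER condMean
  constructor
  · linarith
  · linarith

lemma BER_bounds [IsProbabilityMeasure PZ] (h : Chan PZ lam g) {Ω : Type*} [MeasurableSpace Ω]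
    (μ : Measure Ω) [IsProbabilityMeasure μ] (r m : ℕ) (X Z : Ω → (Fin (2 ^ m) → ℝ))
    (hX : Measurable X) (hZ : Measurable Z)
    (hlaw : Measure.map (fun ω => (X ω, Z ω)) μ
        = (uniformOnFinset (bpskRM r m)).prod (Measure.pi fun _ => PZ)) (i : Fin (2 ^ m)) :
    0 ≤ BER μ (fun ω => X ω i) (fun ω => fun j => X ω j * Z ω j) ∧
    BER μ (fun ω => X ω i) (fun ω => fun j => X ω j * Z ω j) ≤ (1 - qRM PZ g r m) / 2 :=
  BER_bounds_aux h μ (scode_RM r m) X Z hX hZ hlaw i (oo m) (tau m i)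
    (fun _ hx => tau_mem i hx) (by rw [← tau_self m i, tau_tau])

end Ber

/-- For a sequence of RM codes with strictly increasing blocklength and
rate converging to `R ∈ [0, C)`, the maximal bit-error rate under bit-MAP decoding over
the BMS channel with noise law `PZ` converges to zero. -/
theorem stmt_2
    (PZ : Measure ℝ) [IsProbabilityMeasure PZ]
    (hC0 : 0 < capacity PZ) (hC1 : capacity PZ < 1)
    (r m : ℕ → ℕ) (hrm : ∀ n, r n ≤ m n) (hmono : StrictMono m)
    (R : ℝ) (hR0 : 0 ≤ R) (hRC : R < capacity PZ)
    (hRlim : Filter.Tendsto (fun n => RMrate (r n) (m n)) Filter.atTop (nhds R))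
    (Ω : ℕ → Type*) [∀ n, MeasurableSpace (Ω n)]
    (μ : ∀ n, Measure (Ω n)) [∀ n, IsProbabilityMeasure (μ n)]
    (X Z : ∀ n, Ω n → (Fin (2 ^ m n) → ℝ))
    (hX : ∀ n, Measurable (X n)) (hZ : ∀ n, Measurable (Z n))
    (hlaw : ∀ n, Measure.map (fun ω => (X n ω, Z n ω)) (μ n)
        = (uniformOnFinset (bpskRM (r n) (m n))).prod (Measure.pi fun _ => PZ)) :
    Filter.Tendsto
      (fun n => ⨆ i : Fin (2 ^ m n),
        BER (μ n) (fun ω => X n ω i) (fun ω => fun j => X n ω j * Z n ω j))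
      Filter.atTop (nhds 0) := by
  obtain ⟨lam, g, h⟩ := exists_chan_aux PZ
  have hlim := qRM_tendsto h hC0 r m hmono R hRC hRlim
  refine squeeze_zero (fun n => ?_) (fun n => ?_) hlim
  · exact Real.iSup_nonneg fun i =>
      (BER_bounds h (μ n) (r n) (m n) (X n) (Z n) (hX n) (hZ n) (hlaw n) i).1
  · exact ciSup_le fun i =>
      (BER_bounds h (μ n) (r n) (m n) (X n) (Z n) (hX n) (hZ n) (hlaw n) i).2
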